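/- The pseudovariety DO ∩ Ab̄ is κ-reducible for pointlike sets: let S be a finite semigroup and P a (DO ∩ Ab̄)-pointlike subset of S. Then for every finite alphabet A and every surjective homomorphism φ: A⁺ → S from the free semigroup on A, there exists a family (w_p)_{p∈P} of κ-terms over A such that, for each p ∈ P, w_p evaluates to p in S under the letter assignment given by φ restricted to A, and for every finite semigroup T in DO ∩ Ab̄ and every map from A to T, all the terms w_p evaluate to one and the same element of T. -/

import Mathlib

/-- `spow s n` is the power `s^(n+1)` of `s`, defined in any magma. -/
def spow {S : Type*} [Mul S] (s : S) (n : ℕ) : S := (fun x => x * s)^[n] s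

/-- The two-sided ideal of a semigroup `T` generated by the element `s`. -/
def idealGen {T : Type} [Semigroup T] (s : T) : Set T :=
  {x | x = s ∨ (∃ u, x = s * u) ∨ (∃ u, x = u * s) ∨ ∃ u v, x = u * s * v}

/-- The `J`-class of `s`: the set of elements generating the same two-sided
ideal as `s`. -/
def jClass {T : Type} [Semigroup T] (s : T) : Set T :=
  {x | idealGen x = idealGen s}

/-- A rectangular band is a semigroup satisfying `x * y * x = x`. -/
def IsRectangularBand (B : Type) [Semigroup B] : Prop :=
  ∀ x y : B, x * y * x = x

/-- The subset `J` of `T`, which is assumed closed under multiplication, is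
isomorphic as a semigroup (with the induced multiplication) to `B × G`. -/
def IsIsoToProd {T : Type} [Semigroup T] (J : Set T)
    (B G : Type) [Semigroup B] [CommGroup G] : Prop :=
  ∃ φ : ↥J → B × G, Function.Bijective φ ∧
    ∀ (x y : T) (hx : x ∈ J) (hy : y ∈ J) (hxy : x * y ∈ J),
      φ ⟨x * y, hxy⟩ = φ ⟨x, hx⟩ * φ ⟨y, hy⟩

/-- A finite semigroup `T` lies in `DO ∩ Ab̄` if every regular `J`-class of `T`
(i.e. one containing an idempotent) is closed under multiplication and, with
the induced multiplication, is isomorphic to the direct product of a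
rectangular band and an abelian group. -/
def InDOAb (T : Type) [Semigroup T] : Prop :=
  ∀ s : T, (∃ e ∈ jClass s, IsIdempotentElem e) →
    (∀ x ∈ jClass s, ∀ y ∈ jClass s, x * y ∈ jClass s) ∧
    ∃ (B G : Type) (iB : Semigroup B) (iG : CommGroup G),
      @IsRectangularBand B iB ∧ @IsIsoToProd T _ (jClass s) B G iB iG

/-- κ-terms over the alphabet `A`: letters, binary multiplication and the
unary `(ω-1)`-power. -/
inductive KTerm (A : Type) : Type
  | letter : A → KTerm A
  | mul : KTerm A → KTerm A → KTerm A
  | ommPow : KTerm A → KTerm A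

/-- The evaluation relation for κ-terms in a semigroup `T`, given an assignment
`f` of letters.  The `(ω-1)`-power of an element `s` is the element `g` of the
cyclic subsemigroup generated by `s` such that `g * s = s * g = e` and
`g * e = g`, where `e` is the (unique, in a finite semigroup) idempotent power
`s^ω` of `s`. -/
inductive KEval {A T : Type} [Semigroup T] (f : A → T) : KTerm A → T → Prop
  | letter (a : A) : KEval f (KTerm.letter a) (f a)
  | mul {u v : KTerm A} {s t : T} :
      KEval f u s → KEval f v t → KEval f (KTerm.mul u v) (s * t)
  | ommPow {u : KTerm A} {s e g : T} :
      KEval f u s →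
      IsIdempotentElem e → (∃ n : ℕ, spow s n = e) →
      (∃ n : ℕ, spow s n = g) →
      g * s = e → s * g = e → g * e = g →
      KEval f (KTerm.ommPow u) g

/-- `P` is pointlike for the pseudovariety `DO ∩ Ab̄`: for every finite semigroup `T`
in `DO ∩ Ab̄` and every subsemigroup `R` of `S × T` projecting onto `S`, some `t ∈ T`
is related to every element of `P`. -/
def IsDOAbPointlike {S : Type} [Semigroup S] (P : Set S) : Prop :=
  ∀ (T : Type) [Semigroup T] [Finite T], InDOAb T →
    ∀ R : Subsemigroup (S × T),
      (∀ s : S, ∃ t : T, (s, t) ∈ R) →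
      ∃ t : T, ∀ p ∈ P, (p, t) ∈ R


namespace DOAbProof

/-! ### Powers -/

theorem spow_zero {S : Type*} [Mul S] (s : S) : spow s 0 = s := rfl

theorem spow_succ {S : Type*} [Mul S] (s : S) (n : ℕ) : spow s (n + 1) = spow s n * s := by
  simp only [spow, Function.iterate_succ_apply']

theorem spow_mul {S : Type*} [Semigroup S] (s : S) (m n : ℕ) :
    spow s m * spow s n = spow s (m + n + 1) := by
  induction n with
  | zero => rw [spow_zero, ← spow_succ]
  | succ n ih => rw [spow_succ, ← mul_assoc, ih, ← spow_succ]; congr 1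

theorem spow_absorb_right {S : Type*} [Semigroup S] (p s : S) (h : p * s = p) (n : ℕ) :
    p * spow s n = p := by
  induction n with
  | zero => exact h
  | succ n ih => rw [spow_succ, ← mul_assoc, ih, h]

theorem spow_succ' {S : Type*} [Semigroup S] (s : S) (n : ℕ) :
    spow s (n + 1) = s * spow s n := by
  have := spow_mul s 0 n
  rw [spow_zero] at this
  rw [this]; congr 1; omega

theorem spow_absorb_left {S : Type*} [Semigroup S] (p s : S) (h : s * p = p) (n : ℕ) :
    spow s n * p = p := by
  induction n with
  | zero => exact h
  | succ n ih => rw [spow_succ, mul_assoc, h, ih]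

theorem exists_omega {T : Type} [Semigroup T] [Finite T] (s : T) :
    ∃ e g : T, IsIdempotentElem e ∧ (∃ n : ℕ, spow s n = e) ∧ (∃ n : ℕ, spow s n = g) ∧
      g * s = e ∧ s * g = e ∧ g * e = g := by
  obtain ⟨i, j, hne, hij⟩ := Finite.exists_ne_map_eq_of_infinite (fun n : ℕ => spow s n)
  wlog hlt : i < j generalizing i j
  · exact this j i hne.symm hij.symm (by omega)
  change spow s i = spow s j at hij
  obtain ⟨d, rfl⟩ : ∃ d, j = i + d + 1 := ⟨j - i - 1, by omega⟩
  have per : ∀ a, spow s (i + a) = spow s (i + a + (d + 1)) := by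
    intro a
    cases a with
    | zero => exact hij
    | succ a =>
      have h1 := spow_mul s i a
      have h2 := spow_mul s (i + d + 1) a
      rw [← hij, h1] at h2
      have e1 : i + (a + 1) = i + a + 1 := by omega
      have e2 : i + (a + 1) + (d + 1) = i + d + 1 + a + 1 := by omega
      rw [e2, ← h2, e1]
  have per2 : ∀ t a, spow s (i + a) = spow s (i + a + t * (d + 1)) := by
    intro t
    induction t with
    | zero => intro a; simp
    | succ t ih =>
      intro a
      rw [ih a]
      have := per (a + t * (d + 1))
      rw [← add_assoc] at this
      rw [this]; congr 1; ring
  -- exponent K = (d+1)*(i+1)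
  obtain ⟨K, hK⟩ : ∃ K, (i + 1) * (d + 1) = K + 1 := ⟨(i + 1) * (d + 1) - 1, by
    have : 0 < (i + 1) * (d + 1) := by positivity
    omega⟩
  have hKi : i ≤ K := by nlinarith
  have P : ∀ a, i ≤ a → spow s a = spow s (a + (K + 1)) := by
    intro a ha
    obtain ⟨b, rfl⟩ : ∃ b, a = i + b := ⟨a - i, by omega⟩
    rw [per2 (i + 1) b, hK]
  refine ⟨spow s K, spow s (K + K), ?_, ⟨K, rfl⟩, ⟨_, rfl⟩, ?_, ?_, ?_⟩
  · show spow s K * spow s K = spow s K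
    rw [spow_mul, P K hKi]; congr 1
  · rw [← spow_succ, P K hKi]; congr 1
  · rw [← spow_succ', P K hKi]; congr 1
  · rw [spow_mul, P (K + K) (by omega)]; congr 1

theorem exists_keval {A T : Type} [Semigroup T] [Finite T] (f : A → T) (t : KTerm A) :
    ∃ s, KEval f t s := by
  induction t with
  | letter a => exact ⟨_, KEval.letter a⟩
  | mul u v hu hv =>
    obtain ⟨x, hx⟩ := hu
    obtain ⟨y, hy⟩ := hv
    exact ⟨_, hx.mul hy⟩
  | ommPow u hu =>
    obtain ⟨x, hx⟩ := hu
    obtain ⟨e, g, h1, h2, h3, h4, h5, h6⟩ := exists_omega x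
    exact ⟨g, hx.ommPow h1 h2 h3 h4 h5 h6⟩

/-- omega power term -/
def omg {A : Type} (t : KTerm A) : KTerm A := KTerm.mul (KTerm.ommPow t) t

theorem keval_omg {A T : Type} [Semigroup T] [Finite T] (s : T) :
    ∃ e, IsIdempotentElem e ∧ (∃ n, spow s n = e) ∧
      ∀ (f : A → T) (t : KTerm A), KEval f t s → KEval f (omg t) e := by
  obtain ⟨e, g, h1, h2, h3, h4, h5, h6⟩ := exists_omega s
  refine ⟨e, h1, h2, fun f t ht => ?_⟩
  have := (ht.ommPow h1 h2 h3 h4 h5 h6).mul ht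
  rw [h4] at this
  exact this

/-! ### Ideals and regular J-classes -/

section ideals
variable {T : Type} [Semigroup T]

theorem mem_self (x : T) : x ∈ idealGen x := Or.inl rfl

theorem mem_mid (u x v : T) : u * x * v ∈ idealGen x := Or.inr (Or.inr (Or.inr ⟨u, v, rfl⟩))

theorem mem_left (u x : T) : u * x ∈ idealGen x := Or.inr (Or.inr (Or.inl ⟨u, rfl⟩))

theorem mem_right (x u : T) : x * u ∈ idealGen x := Or.inr (Or.inl ⟨u, rfl⟩)

theorem ideal_trans {x y z : T} (h1 : x ∈ idealGen y) (h2 : y ∈ idealGen z) :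
    x ∈ idealGen z := by
  rcases h1 with rfl | ⟨u, rfl⟩ | ⟨u, rfl⟩ | ⟨u, v, rfl⟩ <;>
  rcases h2 with rfl | ⟨u', rfl⟩ | ⟨u', rfl⟩ | ⟨u', v', rfl⟩
  · exact mem_self _
  · exact mem_right _ _
  · exact mem_left _ _
  · exact mem_mid _ _ _
  · exact mem_right _ _
  · rw [mul_assoc]; exact mem_right _ _
  · exact mem_mid _ _ _
  · rw [mul_assoc]; exact mem_mid _ _ _
  · exact mem_left _ _
  · rw [← mul_assoc]; exact mem_mid _ _ _
  · rw [← mul_assoc]; exact mem_left _ _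
  · rw [← mul_assoc, ← mul_assoc]; exact mem_mid _ _ _
  · exact mem_mid _ _ _
  · rw [← mul_assoc, mul_assoc]; exact mem_mid _ _ _
  · rw [← mul_assoc]; exact mem_mid _ _ _
  · rw [← mul_assoc, ← mul_assoc, mul_assoc]; exact mem_mid _ _ _

theorem mem_jClass {x e : T} : x ∈ jClass e ↔ x ∈ idealGen e ∧ e ∈ idealGen x := by
  constructor
  · intro h
    have h' : idealGen x = idealGen e := h
    exact ⟨h' ▸ mem_self x, h'.symm ▸ mem_self e⟩
  · rintro ⟨h1, h2⟩
    show idealGen x = idealGen e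
    ext y
    exact ⟨fun h => ideal_trans h h1, fun h => ideal_trans h h2⟩

theorem jClass_eq {x e : T} (h : x ∈ jClass e) : jClass x = jClass e := by
  have h' : idealGen x = idealGen e := h
  ext y
  show idealGen y = idealGen x ↔ idealGen y = idealGen e
  rw [h']

theorem exists_mid {e x : T} (he : IsIdempotentElem e) (h : e ∈ idealGen x) :
    ∃ u v, e = u * x * v := by
  have he' : e * e = e := he
  rcases h with h | ⟨u, h⟩ | ⟨u, h⟩ | ⟨u, v, h⟩
  · exact ⟨e, e, by rw [← h, he', he']⟩
  · exact ⟨e, u, by rw [mul_assoc, ← h, he']⟩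
  · exact ⟨u, e, by rw [← h, he']⟩
  · exact ⟨u, v, h⟩

theorem spow_mem (s : T) (n : ℕ) : spow s n ∈ idealGen s := by
  cases n with
  | zero => exact mem_self s
  | succ n => rw [spow_succ]; exact mem_left _ _

theorem J_right {e x : T} (he : IsIdempotentElem e)
    (hc : ∀ x ∈ jClass e, ∀ y ∈ jClass e, x * y ∈ jClass e)
    (h : e ∈ idealGen x) : e * x ∈ jClass e := by
  have he' : e * e = e := he
  obtain ⟨u, v, huv⟩ := exists_mid he h
  have hy : x * v * e * u ∈ jClass e := by
    refine mem_jClass.2 ⟨mem_mid _ _ _, ?_⟩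
    have : e = u * (x * v * e * u) * (x * v) := by
      calc e = e * e * e := by rw [he', he']
        _ = (u * x * v) * e * (u * x * v) := by rw [← huv]
        _ = _ := by simp only [mul_assoc]
    have h3 := mem_mid u (x * v * e * u) (x * v)
    rw [← this] at h3
    exact h3
  have h2 := hc e (mem_jClass.2 ⟨mem_self _, mem_self _⟩) _ hy
  refine mem_jClass.2 ⟨mem_right _ _, ideal_trans (mem_jClass.1 h2).2 ?_⟩
  have : e * (x * v * e * u) = (e * x) * (v * e * u) := by simp only [mul_assoc]
  rw [this]; exact mem_right _ _

theorem J_left {e x : T} (he : IsIdempotentElem e)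
    (hc : ∀ x ∈ jClass e, ∀ y ∈ jClass e, x * y ∈ jClass e)
    (h : e ∈ idealGen x) : x * e ∈ jClass e := by
  have he' : e * e = e := he
  obtain ⟨u, v, huv⟩ := exists_mid he h
  have hy : v * e * (u * x) ∈ jClass e := by
    refine mem_jClass.2 ⟨mem_mid _ _ _, ?_⟩
    have : e = (u * x) * (v * e * (u * x)) * v := by
      calc e = e * e * e := by rw [he', he']
        _ = (u * x * v) * e * (u * x * v) := by rw [← huv]
        _ = _ := by simp only [mul_assoc]
    have h3 := mem_mid (u * x) (v * e * (u * x)) v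
    rw [← this] at h3
    exact h3
  have h2 := hc _ hy e (mem_jClass.2 ⟨mem_self _, mem_self _⟩)
  refine mem_jClass.2 ⟨mem_left _ _, ideal_trans (mem_jClass.1 h2).2 ?_⟩
  have : v * e * (u * x) * e = (v * e * u) * (x * e) := by simp only [mul_assoc]
  rw [this]; exact mem_left _ _

/-- Intrinsic consequences of the isomorphism with a rectangular group. -/
theorem J_structure (hT : InDOAb T) {e : T} (he : IsIdempotentElem e) :
    (∀ x ∈ jClass e, ∀ y ∈ jClass e, x * y ∈ jClass e) ∧
    (∀ x ∈ jClass e, ∀ y ∈ jClass e, x * e * y = x * y) ∧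
    (∀ x ∈ jClass e, ∃ g ∈ jClass e, IsIdempotentElem g ∧ x * g = x) ∧
    ∃ (G : Type) (_ : CommGroup G) (γ : T → G),
      (∀ x ∈ jClass e, ∀ y ∈ jClass e, γ (x * y) = γ x * γ y) ∧
      (∀ x ∈ jClass e, ∀ y ∈ jClass e, γ x = γ y → e * x * e = e * y * e) := by
  have hee : e ∈ jClass e := mem_jClass.2 ⟨mem_self _, mem_self _⟩
  obtain ⟨hc, B, G, iB, iG, hB, ψ, hψ, hm⟩ := hT e ⟨e, hee, he⟩
  have b1 : ∀ x : B, x * x = x := by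
    intro x
    have h1 := hB x (x * x)
    have h2 := hB x x
    calc x * x = x * x * x * x := by rw [h2]
      _ = x * (x * x) * x := by simp only [mul_assoc]
      _ = x := h1
  have b2 : ∀ x y z : B, x * y * z = x * z := by
    intro x y z
    calc x * y * z = x * y * (z * x * z) := by rw [hB z x]
      _ = (x * (y * z) * x) * z := by simp only [mul_assoc]
      _ = x * z := by rw [hB]
  have ge : (ψ ⟨e, hee⟩).2 = 1 := by
    have h := hm e e hee hee (hc e hee e hee)
    have h2 : (⟨e * e, hc e hee e hee⟩ : jClass e) = ⟨e, hee⟩ := Subtype.ext he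
    rw [h2] at h
    have := congrArg Prod.snd h
    simpa using this
  have inj : ∀ x (hx : x ∈ jClass e) y (hy : y ∈ jClass e),
      (ψ ⟨x, hx⟩).1 = (ψ ⟨y, hy⟩).1 → (ψ ⟨x, hx⟩).2 = (ψ ⟨y, hy⟩).2 → x = y := by
    intro x hx y hy h1 h2
    have := hψ.1 (Prod.ext h1 h2)
    exact congrArg Subtype.val this
  have m1 : ∀ x (hx : x ∈ jClass e) y (hy : y ∈ jClass e),
      (ψ ⟨x * y, hc x hx y hy⟩).1 = (ψ ⟨x, hx⟩).1 * (ψ ⟨y, hy⟩).1 := by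
    intro x hx y hy; rw [hm x y hx hy]; rfl
  have m2 : ∀ x (hx : x ∈ jClass e) y (hy : y ∈ jClass e),
      (ψ ⟨x * y, hc x hx y hy⟩).2 = (ψ ⟨x, hx⟩).2 * (ψ ⟨y, hy⟩).2 := by
    intro x hx y hy; rw [hm x y hx hy]; rfl
  refine ⟨hc, ?_, ?_, ?_⟩
  · intro x hx y hy
    apply inj _ (hc _ (hc x hx e hee) y hy) _ (hc x hx y hy)
    · rw [m1 _ (hc x hx e hee) y hy, m1 x hx e hee, m1 x hx y hy, b2]
    · rw [m2 _ (hc x hx e hee) y hy, m2 x hx e hee, m2 x hx y hy, ge, mul_one]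
  · intro x hx
    obtain ⟨⟨g, hg⟩, hgψ⟩ := hψ.2 ((ψ ⟨x, hx⟩).1, 1)
    have g1 : (ψ ⟨g, hg⟩).1 = (ψ ⟨x, hx⟩).1 := by rw [hgψ]
    have g2 : (ψ ⟨g, hg⟩).2 = 1 := by rw [hgψ]
    refine ⟨g, hg, ?_, ?_⟩
    · apply inj _ (hc _ hg _ hg) _ hg
      · rw [m1 _ hg _ hg, b1]
      · rw [m2 _ hg _ hg, g2, mul_one]
    · apply inj _ (hc _ hx _ hg) _ hx
      · rw [m1 _ hx _ hg, g1, b1]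
      · rw [m2 _ hx _ hg, g2, mul_one]
  · classical
    refine ⟨G, iG, fun x => if h : x ∈ jClass e then (ψ ⟨x, h⟩).2 else 1, ?_, ?_⟩
    · intro x hx y hy
      simp only [hx, hy, hc x hx y hy, dif_pos]
      exact m2 x hx y hy
    · intro x hx y hy h
      simp only [hx, hy, dif_pos] at h
      apply inj _ (hc _ (hc e hee x hx) e hee) _ (hc _ (hc e hee y hy) e hee)
      · rw [m1 _ (hc e hee x hx) _ hee, m1 _ (hc e hee y hy) _ hee, m1 _ hee _ hx, m1 _ hee _ hy,
          b2, b2]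
      · rw [m2 _ (hc e hee x hx) _ hee, m2 _ (hc e hee y hy) _ hee, m2 _ hee _ hx, m2 _ hee _ hy, h]

theorem U_mul (hT : InDOAb T) {e x y : T} (he : IsIdempotentElem e)
    (hx : e ∈ idealGen x) (hy : e ∈ idealGen y) : e ∈ idealGen (x * y) := by
  obtain ⟨hc, -, hg, -⟩ := J_structure hT he
  have h1 := J_right he hc hx
  obtain ⟨g, hgJ, hgi, hxg⟩ := hg _ h1
  have hJ := jClass_eq hgJ
  have h2 : g * y ∈ jClass g :=
    J_right hgi (by rw [hJ]; exact hc) (ideal_trans (mem_jClass.1 hgJ).1 hy)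
  rw [hJ] at h2
  have h3 := hc _ h1 _ h2
  rw [← mul_assoc, hxg, mul_assoc] at h3
  exact ideal_trans (mem_jClass.1 h3).2 (mem_left _ _)

theorem U_spow (hT : InDOAb T) {e x : T} (he : IsIdempotentElem e)
    (hx : e ∈ idealGen x) (n : ℕ) : e ∈ idealGen (spow x n) := by
  induction n with
  | zero => exact hx
  | succ n ih => rw [spow_succ]; exact U_mul hT he ih hx

end ideals

/-! ### Content and abelianization of terms -/

/-- The set of letters of a term. -/
def content {A : Type} : KTerm A → Set A
  | KTerm.letter a => {a}
  | KTerm.mul u v => content u ∪ content v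
  | KTerm.ommPow u => content u

open Classical in
/-- The value of a term in the free abelian group. -/
noncomputable def ab {A : Type} : KTerm A → (A → ℤ)
  | KTerm.letter a => Pi.single a 1
  | KTerm.mul u v => ab u + ab v
  | KTerm.ommPow u => - ab u

theorem content_nonempty {A : Type} (t : KTerm A) : (content t).Nonempty := by
  induction t with
  | letter a => exact ⟨a, rfl⟩
  | mul u v hu _ => exact hu.mono Set.subset_union_left
  | ommPow u hu => exact hu

theorem keval_le_letter {A T : Type} [Semigroup T] {f : A → T} {t : KTerm A} {x : T}
    (h : KEval f t x) : ∀ a ∈ content t, x ∈ idealGen (f a) := by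
  induction h with
  | letter a => rintro b rfl; exact mem_self _
  | mul _ _ h1 h2 =>
    rintro a (ha | ha)
    · exact ideal_trans (mem_right _ _) (h1 a ha)
    · exact ideal_trans (mem_left _ _) (h2 a ha)
  | ommPow _ _ _ hg _ _ _ ih =>
    intro a ha
    obtain ⟨n, rfl⟩ := hg
    exact ideal_trans (spow_mem _ _) (ih a ha)

theorem letter_le_keval {A T : Type} [Semigroup T] (hT : InDOAb T) {e : T}
    (he : IsIdempotentElem e) {f : A → T} {t : KTerm A} {x : T}
    (h : KEval f t x) : (∀ a ∈ content t, e ∈ idealGen (f a)) → e ∈ idealGen x := by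
  induction h with
  | letter a => intro h; exact h a rfl
  | mul _ _ h1 h2 =>
    intro h
    exact U_mul hT he (h1 fun a ha => h a (Or.inl ha)) (h2 fun a ha => h a (Or.inr ha))
  | ommPow _ _ _ hg _ _ _ ih =>
    intro h
    obtain ⟨n, rfl⟩ := hg
    exact U_spow hT he (ih h) n

theorem sandwich_eq {A T : Type} [Finite A] [Semigroup T] (hT : InDOAb T) {e e' : T}
    (he : IsIdempotentElem e) (he' : e' ∈ jClass e) {f : A → T} {t t' : KTerm A} {x x' : T}
    (h : KEval f t x) (h' : KEval f t' x')
    (ht : ∀ a ∈ content t, e ∈ idealGen (f a)) (ht' : ∀ a ∈ content t', e ∈ idealGen (f a))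
    (hab : ab t = ab t') : e * x * e' = e * x' * e' := by
  obtain ⟨hc, hmid, -, G, iG, γ, hγ, hinj⟩ := J_structure hT he
  have hee : e ∈ jClass e := mem_jClass.2 ⟨mem_self _, mem_self _⟩
  have he2 : e * e = e := he
  have : Fintype A := Fintype.ofFinite A
  have hmul : ∀ x y, e ∈ idealGen x → e ∈ idealGen y →
      γ (e * (x * y) * e) = γ (e * x * e) * γ (e * y * e) := by
    intro x y hx hy
    have h1 := J_right he hc hx
    have h2 := J_left he hc hy
    have h3 := J_right he hc hy
    have : e * (x * y) * e = (e * x * e) * (e * y * e) := by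
      calc e * (x * y) * e = (e * x) * (y * e) := by simp only [mul_assoc]
        _ = (e * x) * e * (y * e) := (hmid _ h1 _ h2).symm
        _ = (e * x) * (e * e) * (y * e) := by rw [he2]
        _ = _ := by simp only [mul_assoc]
    rw [this, hγ _ (hc _ h1 _ hee) _ (hc _ h3 _ hee)]
  have key : ∀ {t : KTerm A} {x : T}, KEval f t x → (∀ a ∈ content t, e ∈ idealGen (f a)) →
      γ (e * x * e) = ∏ a, γ (e * f a * e) ^ (ab t a) := by
    intro t x h
    induction h with
    | letter a =>
      intro _
      classical
      simp only [ab]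
      rw [Finset.prod_eq_single a]
      · simp
      · intro b _ hb; simp [Pi.single_eq_of_ne hb]
      · simp
    | mul k1 k2 h1 h2 =>
      intro h
      have m1 := letter_le_keval hT he k1 fun a ha => h a (Or.inl ha)
      have m2 := letter_le_keval hT he k2 fun a ha => h a (Or.inr ha)
      rw [hmul _ _ m1 m2, h1 fun a ha => h a (Or.inl ha), h2 fun a ha => h a (Or.inr ha)]
      simp only [ab, Pi.add_apply, zpow_add, Finset.prod_mul_distrib]
    | ommPow k hi hn hg hgs hsg hge ih =>
      intro h
      have ih' := ih h
      have m := letter_le_keval hT he k h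
      obtain ⟨ng, hng⟩ := hg
      obtain ⟨ni, hni⟩ := hn
      have m2 := U_spow hT he m ng
      have m3 := U_spow hT he m ni
      rw [hng] at m2
      rw [hni] at m3
      have e1 := hmul _ _ m2 m
      have e2 := hmul _ _ m3 m3
      rw [hi.eq] at e2
      rw [left_eq_mul] at e2
      rw [hgs, e2] at e1
      simp only [ab, Pi.neg_apply, zpow_neg, Finset.prod_inv_distrib]
      change _ = (∏ a, γ (e * f a * e) ^ _)⁻¹
      rw [← ih']
      exact eq_inv_of_mul_eq_one_left e1.symm
  have k1 := key h ht
  have k2 := key h' ht'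
  rw [hab, ← k2] at k1
  have u1 := letter_le_keval hT he h ht
  have u2 := letter_le_keval hT he h' ht'
  have j1 := J_right he hc u1
  have j2 := J_right he hc u2
  have := hinj _ (hc _ j1 _ hee) _ (hc _ j2 _ hee) k1
  have s : ∀ y, e * (e * y * e) * e = e * y * e := by
    intro y
    calc e * (e * y * e) * e = (e * e) * y * (e * e) := by simp only [mul_assoc]
      _ = _ := by rw [he2]
  rw [s, s] at this
  rw [← hmid _ j1 _ he', ← hmid _ j2 _ he', this]



/-! ### kappa-pointlike tuples -/

section KP
variable {A S I : Type} [Semigroup S]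

/-- The value of a word, in `S` with an identity adjoined. -/
def ev (σ : A → S) (l : List A) : WithOne S := (l.map fun a => (σ a : WithOne S)).prod

theorem ev_nil (σ : A → S) : ev σ [] = 1 := rfl

theorem ev_append (σ : A → S) (l m : List A) : ev σ (l ++ m) = ev σ l * ev σ m := by
  simp [ev]

theorem ev_singleton (σ : A → S) (a : A) : ev σ [a] = (σ a : WithOne S) := by
  simp [ev]

/-- All the terms have the same value in every semigroup of the pseudovariety. -/
def VEq (t : I → KTerm A) : Prop :=
  ∀ (T : Type) [Semigroup T] [Finite T], InDOAb T →
    ∀ f : A → T, ∃ s : T, ∀ i, KEval f (t i) s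

/-- The tuple `x` is the value of a tuple of equivalent terms with content `B`. -/
def KP (σ : A → S) (B : Set A) (x : I → WithOne S) : Prop :=
  (B = ∅ ∧ x = 1) ∨ ∃ (t : I → KTerm A) (s : I → S), (∀ i, x i = (s i : WithOne S)) ∧
    (∀ i, KEval σ (t i) (s i)) ∧ (∀ i, content (t i) = B) ∧ VEq t

theorem KP.mul {σ : A → S} {B C : Set A} {x y : I → WithOne S} (hx : KP σ B x)
    (hy : KP σ C y) : KP σ (B ∪ C) (x * y) := by
  rcases hx with ⟨rfl, rfl⟩ | ⟨t, s, h1, h2, h3, h4⟩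
  · simpa using hy
  rcases hy with ⟨rfl, rfl⟩ | ⟨t', s', h1', h2', h3', h4'⟩
  · simp only [Set.union_empty, mul_one]
    exact Or.inr ⟨t, s, h1, h2, h3, h4⟩
  · refine Or.inr ⟨fun i => KTerm.mul (t i) (t' i), fun i => s i * s' i, ?_, ?_, ?_, ?_⟩
    · intro i; rw [Pi.mul_apply, h1, h1', WithOne.coe_mul]
    · intro i; exact (h2 i).mul (h2' i)
    · intro i; simp only [content, h3, h3']
    · intro T _ _ hT f
      obtain ⟨u, hu⟩ := h4 T hT f
      obtain ⟨v, hv⟩ := h4' T hT f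
      exact ⟨u * v, fun i => (hu i).mul (hv i)⟩

theorem KP_letter (σ : A → S) (a : A) : KP σ {a} (fun _ : I => (σ a : WithOne S)) := by
  refine Or.inr ⟨fun _ => KTerm.letter a, fun _ => σ a, fun _ => rfl, fun _ => KEval.letter a,
    fun _ => rfl, ?_⟩
  intro T _ _ hT f
  exact ⟨f a, fun _ => KEval.letter a⟩

theorem KP_sandwich [Finite A] [Finite S] [Nonempty I] {σ : A → S} {B : Set A}
    {p f f' q : I → WithOne S}
    (hB : B.Nonempty) (hp : KP σ B p) (hf : KP σ B f) (hf' : KP σ B f') (hq : KP σ B q)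
    (hpf : p * f = p) (hfq : f' * q = q)
    (τ : I → KTerm A) (z : I → S) (hz : ∀ i, KEval σ (τ i) (z i))
    (hτ : ∀ i, content (τ i) ⊆ B) (hab : ∀ i j, ab (τ i) = ab (τ j)) :
    KP σ B (p * (fun i => (z i : WithOne S)) * q) := by
  rcases hp with ⟨h, -⟩ | ⟨tp, sp, p1, p2, p3, p4⟩
  · exact absurd h hB.ne_empty
  rcases hf with ⟨h, -⟩ | ⟨tf, sf, f1, f2, f3, f4⟩
  · exact absurd h hB.ne_empty
  rcases hf' with ⟨h, -⟩ | ⟨tg, sg, g1, g2, g3, g4⟩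
  · exact absurd h hB.ne_empty
  rcases hq with ⟨h, -⟩ | ⟨tq, sq, q1, q2, q3, q4⟩
  · exact absurd h hB.ne_empty
  refine Or.inr ⟨fun i => KTerm.mul (KTerm.mul (tp i) (KTerm.mul (KTerm.mul (omg (tf i)) (τ i))
    (omg (tg i)))) (tq i), fun i => sp i * z i * sq i, ?_, ?_, ?_, ?_⟩
  · intro i; simp only [Pi.mul_apply, p1, q1, WithOne.coe_mul]
  · intro i
    obtain ⟨e, -, ⟨n, hn⟩, he⟩ := keval_omg (A := A) (sf i)
    obtain ⟨e', -, ⟨n', hn'⟩, he'⟩ := keval_omg (A := A) (sg i)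
    have k := ((p2 i).mul (((he σ _ (f2 i)).mul (hz i)).mul (he' σ _ (g2 i)))).mul (q2 i)
    have a1 : sp i * sf i = sp i := by
      have := congrFun hpf i
      rw [Pi.mul_apply, p1, f1, ← WithOne.coe_mul] at this
      exact WithOne.coe_inj.1 this
    have a2 : sg i * sq i = sq i := by
      have := congrFun hfq i
      rw [Pi.mul_apply, q1, g1, ← WithOne.coe_mul] at this
      exact WithOne.coe_inj.1 this
    have b1 := spow_absorb_right _ _ a1 n
    have b2 := spow_absorb_left _ _ a2 n'
    rw [hn] at b1
    rw [hn'] at b2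
    have c : sp i * (e * z i * e') * sq i = sp i * z i * sq i := by
      calc sp i * (e * z i * e') * sq i = (sp i * e) * z i * (e' * sq i) := by
            simp only [mul_assoc]
        _ = _ := by rw [b1, b2]
    rw [c] at k
    exact k
  · intro i
    have := hτ i
    simp only [content, omg, p3, f3, g3, q3]
    ext a
    constructor
    · simp only [Set.mem_union]
      have := @this a
      tauto
    · intro h; exact Or.inr h
  · intro T _ _ hT f
    obtain ⟨vp, hvp⟩ := p4 T hT f
    obtain ⟨vf, hvf⟩ := f4 T hT f
    obtain ⟨vg, hvg⟩ := g4 T hT f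
    obtain ⟨vq, hvq⟩ := q4 T hT f
    obtain ⟨e, hei, ⟨n, hn⟩, he⟩ := keval_omg (A := A) vf
    obtain ⟨e', hei', ⟨n', hn'⟩, he'⟩ := keval_omg (A := A) vg
    obtain ⟨i0⟩ := ‹Nonempty I›
    have le : ∀ a ∈ B, e ∈ idealGen (f a) := by
      intro a ha
      have := keval_le_letter (he f _ (hvf i0)) a
      simp only [content, omg, f3] at this
      exact this (Or.inl ha)
    have le' : ∀ a ∈ B, e' ∈ idealGen (f a) := by
      intro a ha
      have := keval_le_letter (he' f _ (hvg i0)) a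
      simp only [content, omg, g3] at this
      exact this (Or.inl ha)
    have hJ : e' ∈ jClass e := by
      refine mem_jClass.2 ⟨?_, ?_⟩
      · refine letter_le_keval hT hei' (he f _ (hvf i0)) ?_
        simp only [content, omg, f3, Set.union_self]
        exact le'
      · refine letter_le_keval hT hei (he' f _ (hvg i0)) ?_
        simp only [content, omg, g3, Set.union_self]
        exact le
    choose y hy using fun i => exists_keval f (τ i)
    refine ⟨vp * (e * y i0 * e') * vq, fun i => ?_⟩
    have k := ((hvp i).mul (((he f _ (hvf i)).mul (hy i)).mul (he' f _ (hvg i)))).mul (hvq i)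
    have := sandwich_eq hT hei hJ (hy i) (hy i0) (fun a ha => le a (hτ i ha))
      (fun a ha => le a (hτ i0 ha)) (hab i i0)
    rw [this] at k
    exact k

end KP

/-! ### The abelian part -/

section abelian
variable {A S I : Type} [Semigroup S]

open Classical in
/-- Commutative image of a word. -/
noncomputable def parikh (l : List A) : A → ℤ := (l.map fun a => Pi.single a (1 : ℤ)).sum

theorem parikh_append (l m : List A) : parikh (l ++ m) = parikh l + parikh m := by
  simp [parikh]

theorem parikh_nil : parikh ([] : List A) = 0 := rfl

theorem pigeon {X K : Type} [Finite K] (F : List X → K) (l : List X)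
    (h : Nat.card K ≤ l.length) :
    ∃ l1 l2 l3, l = l1 ++ l2 ++ l3 ∧ l2 ≠ [] ∧ F l1 = F (l1 ++ l2) := by
  have := Fintype.ofFinite K
  have hcard : Fintype.card K < Fintype.card (Fin (l.length + 1)) := by
    rw [Fintype.card_fin, ← Nat.card_eq_fintype_card]; omega
  obtain ⟨i, j, hne, hij⟩ := Fintype.exists_ne_map_eq_of_card_lt
    (fun i : Fin (l.length + 1) => F (l.take i)) hcard
  wlog hlt : i < j generalizing i j
  · exact this j i hne.symm hij.symm (lt_of_le_of_ne (not_lt.1 hlt) hne.symm)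
  have hlt' : (i : ℕ) < j := hlt
  have hj := j.2
  have e1 : l.take i ++ (l.drop i).take (j - i) = l.take j := by
    rw [← List.take_add]; congr 1; omega
  refine ⟨l.take i, (l.drop i).take (j - i), l.drop j, ?_, ?_, ?_⟩
  · rw [e1, List.take_append_drop]
  · intro h
    have := congrArg List.length h
    simp only [List.length_take, List.length_drop, List.length_nil] at this
    omega
  · rw [e1]; exact hij

/-- The group of abelian values of loops at `q`. -/
noncomputable def loopSub [Finite S] (σ : A → S) (B : Set A) (q : WithOne S) :
    AddSubgroup (A → ℤ) where
  carrier := {δ | δ = 0 ∨ ∃ t s, KEval σ t s ∧ content t ⊆ B ∧ q * (s : WithOne S) = q ∧ ab t = δ}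
  zero_mem' := Or.inl rfl
  add_mem' := by
    rintro a b (rfl | ⟨t, s, h1, h2, h3, rfl⟩) hb
    · simpa using hb
    · rcases hb with rfl | ⟨t', s', h1', h2', h3', rfl⟩
      · right; exact ⟨t, s, h1, h2, h3, by simp⟩
      · right
        refine ⟨KTerm.mul t t', s * s', h1.mul h1', Set.union_subset h2 h2', ?_, rfl⟩
        rw [WithOne.coe_mul, ← mul_assoc, h3, h3']
  neg_mem' := by
    rintro a (rfl | ⟨t, s, h1, h2, h3, rfl⟩)
    · left; simp
    · right
      obtain ⟨e, g, k1, k2, k3, k4, k5, k6⟩ := exists_omega s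
      refine ⟨KTerm.ommPow t, g, h1.ommPow k1 k2 k3 k4 k5 k6, h2, ?_, rfl⟩
      obtain ⟨n, rfl⟩ := k3
      clear k4 k5 k6
      induction n with
      | zero => exact h3
      | succ n ih => rw [spow_succ, WithOne.coe_mul, ← mul_assoc, ih, h3]

theorem mem_loopSub [Finite S] {σ : A → S} {B : Set A} {q : WithOne S} {δ : A → ℤ} :
    δ ∈ loopSub σ B q ↔ δ = 0 ∨ ∃ t s, KEval σ t s ∧ content t ⊆ B ∧
      q * (s : WithOne S) = q ∧ ab t = δ := Iff.rfl

/-- The values of the prefixes of a word. -/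
def vis (σ : A → S) (z : List A) : Set (WithOne S) := {q | ∃ l m, z = l ++ m ∧ q = ev σ l}

/-- Group generated by loops at all vertices in `Q`. -/
noncomputable def Lam [Finite S] (σ : A → S) (B : Set A) (Q : Set (WithOne S)) :
    AddSubgroup (A → ℤ) := ⨆ q ∈ Q, loopSub σ B q

theorem term_of_word [Finite S] (σ : A → S) (B : Set A) (z : List A) (hz : ∀ a ∈ z, a ∈ B) :
    ∀ δ ∈ Lam σ B (vis σ z), (z = [] ∧ δ = 0) ∨
      ∃ t s, KEval σ t s ∧ content t ⊆ B ∧ ev σ z = (s : WithOne S) ∧ ab t = parikh z + δ := by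
  induction z using List.reverseRecOn with
  | nil =>
    intro δ hδ
    left
    refine ⟨rfl, ?_⟩
    have : vis σ ([] : List A) = {1} := by
      ext q
      simp [vis, ev_nil]
    rw [this, Lam, iSup_singleton, mem_loopSub] at hδ
    rcases hδ with h | ⟨t, s, -, -, h, -⟩
    · exact h
    · rw [one_mul] at h
      exact absurd h (WithOne.coe_ne_one)
  | append_singleton z c ih =>
    intro δ hδ
    right
    have hv : vis σ (z ++ [c]) = vis σ z ∪ {ev σ (z ++ [c])} := by
      ext q
      constructor
      · rintro ⟨l, m, h, rfl⟩
        rcases List.eq_nil_or_concat m with rfl | ⟨m', x, rfl⟩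
        · right; rw [h]; simp
        · left
          rw [List.concat_eq_append, ← List.append_assoc] at h
          exact ⟨l, m', (List.append_inj' h rfl).1, rfl⟩
      · rintro (⟨l, m, h, rfl⟩ | h)
        · exact ⟨l, m ++ [c], by rw [h, List.append_assoc], rfl⟩
        · exact ⟨z ++ [c], [], by simp, h⟩
    rw [hv, Lam, iSup_union, iSup_singleton] at hδ
    obtain ⟨δ1, h1, δ2, h2, rfl⟩ := AddSubgroup.mem_sup.1 hδ
    have base : ∃ t s, KEval σ t s ∧ content t ⊆ B ∧ ev σ (z ++ [c]) = (s : WithOne S) ∧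
        ab t = parikh (z ++ [c]) + δ1 := by
      have hc : c ∈ B := hz c (by simp)
      rcases ih (fun a ha => hz a (by simp [ha])) δ1 h1 with ⟨rfl, rfl⟩ | ⟨t, s, k1, k2, k3, k4⟩
      · refine ⟨KTerm.letter c, σ c, KEval.letter c, by simpa [content] using hc, ?_, ?_⟩
        · simp [ev]
        · simp [ab, parikh]
      · refine ⟨KTerm.mul t (KTerm.letter c), s * σ c, k1.mul (KEval.letter c),
          Set.union_subset k2 (by simpa [content] using hc), ?_, ?_⟩
        · rw [ev_append, k3, ev_singleton, WithOne.coe_mul]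
        · rw [parikh_append]
          simp only [ab, k4]
          simp [parikh]
          abel
    obtain ⟨t, s, k1, k2, k3, k4⟩ := base
    rcases mem_loopSub.1 h2 with rfl | ⟨t', s', j1, j2, j3, rfl⟩
    · exact ⟨t, s, k1, k2, k3, by rw [k4, add_zero]⟩
    · refine ⟨KTerm.mul t t', s * s', k1.mul j1, Set.union_subset k2 j2, ?_, ?_⟩
      · rw [WithOne.coe_mul, ← k3, j3]
      · simp only [ab, k4]; abel

theorem Lam_mono [Finite S] (σ : A → S) (B : Set A) {Q Q' : Set (WithOne S)} (h : Q ⊆ Q') :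
    Lam σ B Q ≤ Lam σ B Q' := biSup_mono h

theorem short_word [Finite S] (σ : A → S) (B : Set A) (Q : Set (WithOne S)) :
    ∀ (n : ℕ) (z : List A), z.length ≤ n → (∀ a ∈ z, a ∈ B) → vis σ z ⊆ Q →
      ∃ p : List A, p.length ≤ Nat.card (WithOne S) ∧ parikh z - parikh p ∈ Lam σ B Q := by
  have : Finite (WithOne S) := inferInstanceAs (Finite (Option S))
  intro n
  induction n with
  | zero =>
    intro z hz _ _
    exact ⟨z, by omega, by simp⟩
  | succ n ih =>
    intro z hz hB hQ
    by_cases hlen : z.length ≤ Nat.card (WithOne S)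
    · exact ⟨z, hlen, by simp⟩
    obtain ⟨x, v, y, rfl, hv, hxv⟩ := pigeon (ev σ) z (by omega)
    have hvl : 0 < v.length := List.length_pos_iff.2 hv
    obtain ⟨p, hp, hpL⟩ := ih (x ++ y) (by simp at hz ⊢; omega)
      (fun a ha => hB a (by simp at ha ⊢; tauto)) (by
        rintro q ⟨l, m, h, rfl⟩
        rcases List.append_eq_append_iff.1 h with ⟨a, rfl, rfl⟩ | ⟨c, rfl, rfl⟩
        · exact hQ ⟨x ++ v ++ a, m, by simp, by rw [ev_append, ev_append, ← hxv]⟩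
        · exact hQ ⟨l, c ++ v ++ y, by simp, rfl⟩)
    refine ⟨p, hp, ?_⟩
    have hloop : parikh v ∈ loopSub σ B (ev σ x) := by
      rcases term_of_word σ B v (fun a ha => hB a (by simp [ha])) 0 (zero_mem _) with
        ⟨h, -⟩ | ⟨t, s, h1, h2, h3, h4⟩
      · exact absurd h hv
      · refine mem_loopSub.2 (Or.inr ⟨t, s, h1, h2, ?_, by rw [h4, add_zero]⟩)
        rw [← h3, ← ev_append]; exact hxv.symm
    have hloop2 : parikh v ∈ Lam σ B Q := by
      have : ev σ x ∈ Q := hQ ⟨x, v ++ y, by simp, rfl⟩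
      exact (le_biSup (fun q => loopSub σ B q) this) hloop
    have : parikh (x ++ v ++ y) - parikh p = (parikh (x ++ y) - parikh p) + parikh v := by
      simp only [parikh_append]; abel
    rw [this]
    exact add_mem hpL hloop2

theorem residual {V : Type} [AddCommGroup V] [Module.Finite ℤ V] (D : AddSubgroup V) (v : V)
    (hv : v ∉ D) : ∃ n : ℕ, 0 < n ∧ ∀ y : V, v - n • y ∉ D := by
  by_contra hcon
  push Not at hcon
  let K := V ⧸ D.toIntSubmodule
  let x : K := Submodule.Quotient.mk v
  have hx : ∀ n : ℕ, 0 < n → ∃ y : K, x = n • y := by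
    intro n hn
    obtain ⟨y, hy⟩ := hcon n hn
    refine ⟨Submodule.Quotient.mk y, ?_⟩
    rw [← Submodule.Quotient.mk_smul]
    exact (Submodule.Quotient.eq _).2 hy
  have key : ∀ p : ℕ, 0 < p → ∃ r : ℤ, (1 - p * r) • x = 0 := by
    intro p hp
    have hmem : x ∈ (⨅ i : ℕ, (Ideal.span {(p : ℤ)}) ^ i • (⊤ : Submodule ℤ K)) := by
      rw [Submodule.mem_iInf]
      intro i
      obtain ⟨y, hy⟩ := hx (p ^ i) (by positivity)
      rw [hy, ← natCast_zsmul, Ideal.span_singleton_pow]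
      refine Submodule.smul_mem_smul (Ideal.mem_span_singleton.2 (by simp)) trivial
    obtain ⟨⟨r, hr⟩, hrx⟩ := (Ideal.mem_iInf_smul_pow_eq_bot_iff _ _).1 hmem
    obtain ⟨c, rfl⟩ := Ideal.mem_span_singleton.1 hr
    refine ⟨c, ?_⟩
    rw [sub_smul, one_smul]
    simp only at hrx
    exact sub_eq_zero.2 hrx.symm
  have hx0 : x ≠ 0 := by
    intro h
    exact hv ((Submodule.Quotient.mk_eq_zero _).1 h)
  obtain ⟨r, hr⟩ := key 2 (by norm_num)
  have hfin : addOrderOf x ≠ 0 := by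
    intro h0
    have := addOrderOf_dvd_iff_zsmul_eq_zero.2 hr
    rw [h0] at this
    have := zero_dvd_iff.1 (by simpa using this)
    omega
  have hne1 : addOrderOf x ≠ 1 := fun h => hx0 (AddMonoid.addOrderOf_eq_one_iff.1 h)
  obtain ⟨r', hr'⟩ := key (addOrderOf x) (Nat.pos_of_ne_zero hfin)
  have h1 := addOrderOf_dvd_iff_zsmul_eq_zero.2 hr'
  have h2 : (addOrderOf x : ℤ) ∣ 1 := by
    have := dvd_add h1 (Dvd.intro r' rfl : (addOrderOf x : ℤ) ∣ addOrderOf x * r')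
    simpa using this
  exact hne1 (by exact_mod_cast Int.eq_one_of_dvd_one (by positivity) h2)

/-- Tuples that agree up to correction by loops. -/
def Dgrp [Finite S] (σ : A → S) (B : Set A) (Q : I → Set (WithOne S)) :
    AddSubgroup (I → A → ℤ) where
  carrier := {v | ∃ d, ∀ i, v i - d ∈ Lam σ B (Q i)}
  zero_mem' := ⟨0, fun i => by simp⟩
  add_mem' := by
    rintro v w ⟨d, hd⟩ ⟨d', hd'⟩
    refine ⟨d + d', fun i => ?_⟩
    have := add_mem (hd i) (hd' i)
    rw [Pi.add_apply]
    convert this using 1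
    abel
  neg_mem' := by
    rintro v ⟨d, hd⟩
    refine ⟨-d, fun i => ?_⟩
    have := neg_mem (hd i)
    rw [Pi.neg_apply]
    convert this using 1
    abel

theorem abelian_main [Finite S] [Finite A] [Finite I] [Nonempty I] (σ : A → S) :
    ∃ n : ℕ, 0 < n ∧ ∀ (B : Set A) (z : I → List A), (∀ i, z i ≠ []) →
      (∀ i, ∀ a ∈ z i, a ∈ B) →
      (∀ i j a, ((parikh (z i) a : ℤ) : ZMod n) = ((parikh (z j) a : ℤ) : ZMod n)) →
      ∃ (τ : I → KTerm A) (s : I → S), (∀ i, KEval σ (τ i) (s i)) ∧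
        (∀ i, content (τ i) ⊆ B) ∧ (∀ i, ev σ (z i) = (s i : WithOne S)) ∧
        (∀ i j, ab (τ i) = ab (τ j)) := by
  classical
  have : Finite (WithOne S) := inferInstanceAs (Finite (Option S))
  have : Finite {l : List A // l.length ≤ Nat.card (WithOne S)} :=
    (List.finite_length_le A (Nat.card (WithOne S))).to_subtype
  let X := Set A × (I → Set (WithOne S)) × (I → {l : List A // l.length ≤ Nat.card (WithOne S)})
  have : Fintype X := Fintype.ofFinite X
  have hX : ∀ x : X, ∃ n : ℕ, 0 < n ∧ ((fun i => parikh (x.2.2 i).1) ∉ Dgrp σ x.1 x.2.1 →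
      ∀ y, (fun i => parikh (x.2.2 i).1) - n • y ∉ Dgrp σ x.1 x.2.1) := by
    intro x
    by_cases h : (fun i => parikh (x.2.2 i).1) ∈ Dgrp σ x.1 x.2.1
    · exact ⟨1, one_pos, fun h' => absurd h h'⟩
    · obtain ⟨n, hn, h2⟩ := residual _ _ h
      exact ⟨n, hn, fun _ => h2⟩
  choose N hN hN2 using hX
  refine ⟨∏ x, N x, Finset.prod_pos fun x _ => hN x, ?_⟩
  intro B z hz hzB hmod
  choose p hp hpL using fun i => short_word σ B (vis σ (z i)) _ (z i) le_rfl (hzB i) le_rfl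
  let x : X := (B, fun i => vis σ (z i), fun i => ⟨p i, hp i⟩)
  have hD : (fun i => parikh (p i)) ∈ Dgrp σ B (fun i => vis σ (z i)) := by
    by_contra hcon
    have h3 := hN2 x hcon
    obtain ⟨i0⟩ := ‹Nonempty I›
    have hdvd : ∀ i a, ∃ c : ℤ, parikh (z i) a - parikh (z i0) a = N x * c := by
      intro i a
      have h4 := (ZMod.intCast_eq_intCast_iff_dvd_sub _ _ _).1 (hmod i0 i a)
      have h5 : ((N x : ℕ) : ℤ) ∣ ((∏ x, N x : ℕ) : ℤ) :=
        Int.natCast_dvd_natCast.2 (Finset.dvd_prod_of_mem N (Finset.mem_univ x))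
      exact h5.trans h4
    choose c hc using hdvd
    refine h3 c ⟨parikh (z i0), fun i => ?_⟩
    have h6 : ((fun i => parikh (p i)) - N x • c) i - parikh (z i0) =
        -(parikh (z i) - parikh (p i)) := by
      ext a
      have := hc i a
      change parikh (p i) a - N x • c i a - parikh (z i0) a = -(parikh (z i) a - parikh (p i) a)
      rw [nsmul_eq_mul]
      linarith
    have h7 := neg_mem (hpL i)
    rw [← h6] at h7
    exact h7
  obtain ⟨d, hd⟩ := hD
  have hex : ∀ i, ∃ t s, KEval σ t s ∧ content t ⊆ B ∧ ev σ (z i) = (s : WithOne S) ∧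
      ab t = d := by
    intro i
    have h8 : d - parikh (z i) ∈ Lam σ B (vis σ (z i)) := by
      have := neg_mem (add_mem (hpL i) (hd i))
      convert this using 1
      abel
    rcases term_of_word σ B (z i) (hzB i) _ h8 with ⟨h, -⟩ | ⟨t, s, h1, h2, h3, h4⟩
    · exact absurd h (hz i)
    · exact ⟨t, s, h1, h2, h3, by rw [h4]; abel⟩
  choose τ s h1 h2 h3 h4 using hex
  exact ⟨τ, s, h1, h2, h3, fun i j => by rw [h4, h4]⟩

end abelian



/-! ### A criterion for membership in the pseudovariety -/

section criterion
variable {T : Type} [Semigroup T]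

theorem map_spow {G : Type} [CommGroup G] (π : T → G) (hπ : ∀ x y, π (x * y) = π x * π y)
    (x : T) (m : ℕ) : π (spow x m) = π x ^ (m + 1) := by
  induction m with
  | zero => simp [spow_zero]
  | succ m ih => rw [spow_succ, hπ, ih, ← pow_succ]

theorem inDOAb_of {A G : Type} [CommGroup G] (π : T → G) (hπ : ∀ x y, π (x * y) = π x * π y)
    (N : ℕ) (hN : ∀ g : G, g ^ (N + 1) = 1) (c : T → Set A)
    (hc : ∀ x y, c (x * y) = c x ∪ c y)
    (hmain : ∀ e x y : T, IsIdempotentElem e → c x ⊆ c e → c y ⊆ c e → π x = π y →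
      e * x * e = e * y * e) : InDOAb T := by
  intro s0 ⟨e, heJ, hei⟩
  rw [← jClass_eq heJ]
  clear heJ
  have πi : ∀ f : T, IsIdempotentElem f → π f = 1 := by
    intro f hf
    have := hπ f f
    rw [hf.eq] at this
    exact left_eq_mul.1 this
  have c_ideal : ∀ x y : T, x ∈ idealGen y → c y ⊆ c x := by
    rintro x y (rfl | ⟨u, rfl⟩ | ⟨u, rfl⟩ | ⟨u, v, rfl⟩)
    · exact le_rfl
    · rw [hc]; exact Set.subset_union_left
    · rw [hc]; exact Set.subset_union_right
    · rw [hc, hc]; exact Set.subset_union_right.trans Set.subset_union_left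
  have cJ : ∀ x ∈ jClass e, c x = c e := fun x hx =>
    Set.Subset.antisymm (c_ideal _ _ (mem_jClass.1 hx).2) (c_ideal _ _ (mem_jClass.1 hx).1)
  have c_spow : ∀ (x : T) (m : ℕ), c (spow x m) = c x := by
    intro x m
    induction m with
    | zero => rfl
    | succ m ih => rw [spow_succ, hc, ih, Set.union_self]
  have πpow : ∀ x : T, π (spow x N) = 1 := fun x => by rw [map_spow π hπ, hN]
  have absorb : ∀ f x : T, IsIdempotentElem f → c x ⊆ c f → π x = 1 → f * x * f = f := by
    intro f x hf hx h1
    have := hmain f x f hf hx le_rfl (by rw [h1, πi f hf])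
    rw [this, hf.eq, hf.eq]
  have closed : ∀ x ∈ jClass e, ∀ y ∈ jClass e, x * y ∈ jClass e := by
    intro x hx y hy
    refine mem_jClass.2 ⟨ideal_trans (mem_right x y) (mem_jClass.1 hx).1, ?_⟩
    have h := absorb e (spow (x * y) N) hei (by rw [c_spow, hc, cJ x hx, cJ y hy, Set.union_self])
      (πpow _)
    have h2 := mem_mid e (spow (x * y) N) e
    rw [h] at h2
    exact ideal_trans h2 (spow_mem _ _)
  have spowJ : ∀ x ∈ jClass e, ∀ m, spow x m ∈ jClass e := by
    intro x hx m
    induction m with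
    | zero => exact hx
    | succ m ih => rw [spow_succ]; exact closed _ ih _ hx
  have heJ : e ∈ jClass e := mem_jClass.2 ⟨mem_self _, mem_self _⟩
  have reg : ∀ x ∈ jClass e, spow x N * x = x := by
    intro x hx
    obtain ⟨a, b, hab, hca, hcb⟩ : ∃ a b, x = a * e * b ∧ c a ⊆ c e ∧ c b ⊆ c e := by
      have hx1 := (mem_jClass.1 hx).1
      have hcx := cJ x hx
      have : ∃ a b, x = a * e * b := by
        rcases hx1 with h | ⟨u, h⟩ | ⟨u, h⟩ | ⟨u, v, h⟩
        · exact ⟨e, e, by rw [h, hei.eq, hei.eq]⟩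
        · exact ⟨e, u, by rw [hei.eq, h]⟩
        · exact ⟨u, e, by rw [mul_assoc, hei.eq, h]⟩
        · exact ⟨u, v, h⟩
      obtain ⟨a, b, hab⟩ := this
      refine ⟨a, b, hab, ?_, ?_⟩
      · rw [← hcx, hab, hc, hc]; exact Set.subset_union_left.trans Set.subset_union_left
      · rw [← hcx, hab, hc]; exact Set.subset_union_right
    have hstep : ∀ m, spow x m * x = a * e * spow (e * (b * a) * e) m * (e * b) := by
      intro m
      induction m with
      | zero =>
        rw [spow_zero, spow_zero]
        calc x * x = (a * e * b) * (a * e * b) := by rw [← hab]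
          _ = (a * (e * e) * b) * (a * (e * e) * b) := by rw [hei.eq]
          _ = _ := by simp only [mul_assoc]
      | succ m ih =>
        rw [spow_succ, ih, spow_succ]
        calc a * e * spow (e * (b * a) * e) m * (e * b) * x
            = a * e * spow (e * (b * a) * e) m * (e * b) * (a * e * b) := by rw [← hab]
          _ = a * e * spow (e * (b * a) * e) m * (e * b) * (a * (e * e) * b) := by rw [hei.eq]
          _ = _ := by simp only [mul_assoc]
    have hz : e * spow (e * (b * a) * e) N * e = e := by
      refine absorb e _ hei ?_ (πpow _)
      rw [c_spow, hc, hc, hc]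
      exact Set.union_subset (Set.union_subset le_rfl (Set.union_subset hcb hca)) le_rfl
    rw [hstep]
    calc a * e * spow (e * (b * a) * e) N * (e * b)
        = a * (e * spow (e * (b * a) * e) N * e) * b := by simp only [mul_assoc]
      _ = x := by rw [hz, hab]
  have reg' : ∀ x ∈ jClass e, x * spow x N = x := by
    intro x hx
    rw [← spow_succ', spow_succ, reg x hx]
  have idem : ∀ x ∈ jClass e, IsIdempotentElem (spow x N) := by
    intro x hx
    have : ∀ m, spow x N * spow x m = spow x m := by
      intro m
      induction m with
      | zero => exact reg x hx
      | succ m ih => rw [spow_succ, ← mul_assoc, ih]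
    exact this N
  have hfg : ∀ f g : T, f ∈ jClass e → IsIdempotentElem f → g ∈ jClass e → π g = 1 →
      f * g * f = f := by
    intro f g hf hfi hg hg1
    exact absorb f g hfi (by rw [cJ f hf, cJ g hg]) hg1
  have powmul : ∀ x ∈ jClass e, ∀ y ∈ jClass e, spow (x * y) N = spow x N * spow y N := by
    intro x hx y hy
    have hxy := closed x hx y hy
    have e1 : spow x N * spow (x * y) N = spow (x * y) N := by
      have : ∀ m, spow x N * spow (x * y) m = spow (x * y) m := by
        intro m
        induction m with
        | zero => rw [spow_zero, ← mul_assoc, reg x hx]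
        | succ m ih => rw [spow_succ, ← mul_assoc, ih]
      exact this N
    have e2 : spow (x * y) N * spow y N = spow (x * y) N := by
      have : ∀ m, spow (x * y) m * spow y N = spow (x * y) m := by
        intro m
        induction m with
        | zero => rw [spow_zero, mul_assoc, reg' y hy]
        | succ m ih => rw [spow_succ', mul_assoc, ih]
      exact this N
    have jx := spowJ x hx N
    have jy := spowJ y hy N
    have jxy := spowJ _ hxy N
    calc spow (x * y) N = spow x N * spow (x * y) N * spow y N := by rw [e1, e2]
      _ = spow x N * spow (x * y) N * (spow y N * spow x N * spow y N) := by
          rw [hfg _ _ jy (idem y hy) jx (πpow x)]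
      _ = (spow x N * (spow (x * y) N * spow y N) * spow x N) * spow y N := by
          simp only [mul_assoc]
      _ = _ := by
          rw [e2, hfg _ _ jx (idem x hx) jxy (πpow _)]
  have idem_pow : ∀ f : T, IsIdempotentElem f → ∀ m, spow f m = f := by
    intro f hf m
    induction m with
    | zero => rfl
    | succ m ih => rw [spow_succ, ih, hf.eq]
  refine ⟨closed, ?_⟩
  let B := {x : T // x ∈ jClass e ∧ IsIdempotentElem x}
  have Bmul : ∀ x y : B, x.1 * y.1 ∈ jClass e ∧ IsIdempotentElem (x.1 * y.1) := by
    intro x y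
    have h := closed _ x.2.1 _ y.2.1
    refine ⟨h, ?_⟩
    have := idem _ h
    rwa [powmul _ x.2.1 _ y.2.1, idem_pow _ x.2.2, idem_pow _ y.2.2] at this
  let iB : Semigroup B :=
    { mul := fun x y => ⟨x.1 * y.1, Bmul x y⟩
      mul_assoc := fun x y z => Subtype.ext (mul_assoc x.1 y.1 z.1) }
  let G' : Subgroup G :=
    { carrier := {g | ∃ x ∈ jClass e, π x = g}
      one_mem' := ⟨e, heJ, πi e hei⟩
      mul_mem' := by
        rintro _ _ ⟨x, hx, rfl⟩ ⟨y, hy, rfl⟩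
        exact ⟨x * y, closed x hx y hy, hπ x y⟩
      inv_mem' := by
        rintro _ ⟨x, hx, rfl⟩
        refine ⟨spow x (2 * N), spowJ x hx _, ?_⟩
        rw [map_spow π hπ]
        refine eq_inv_of_mul_eq_one_left ?_
        rw [← pow_succ]
        have : 2 * N + 1 + 1 = (N + 1) * 2 := by ring
        rw [this, pow_mul, hN, one_pow] }
  refine ⟨B, G', iB, inferInstance, ?_, ?_⟩
  · intro x y
    refine Subtype.ext ?_
    change x.1 * y.1 * x.1 = x.1
    exact hfg _ _ x.2.1 x.2.2 y.2.1 (πi _ y.2.2)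
  · refine ⟨fun x => (⟨spow x.1 N, spowJ _ x.2 N, idem _ x.2⟩, ⟨π x.1, x.1, x.2, rfl⟩),
      ⟨?_, ?_⟩, ?_⟩
    · rintro ⟨x, hx⟩ ⟨y, hy⟩ h
      have h1 : spow x N = spow y N := congrArg Subtype.val (congrArg Prod.fst h)
      have h2 : π x = π y := congrArg Subtype.val (congrArg Prod.snd h)
      refine Subtype.ext ?_
      change x = y
      have hJ := spowJ x hx N
      have h3 := hmain (spow x N) x y (idem x hx) (by rw [cJ _ hJ, cJ x hx])
        (by rw [cJ _ hJ, cJ y hy]) h2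
      rw [reg x hx, reg' x hx, h1, reg y hy, reg' y hy] at h3
      exact h3
    · rintro ⟨⟨f, hf, hfi⟩, ⟨_, x, hx, rfl⟩⟩
      have hJ : f * x * f ∈ jClass e := closed _ (closed _ hf _ hx) _ hf
      refine ⟨⟨f * x * f, hJ⟩, ?_⟩
      refine Prod.ext (Subtype.ext ?_) (Subtype.ext ?_)
      · change spow (f * x * f) N = f
        rw [powmul _ (closed _ hf _ hx) _ hf, powmul _ hf _ hx, idem_pow f hfi]
        exact hfg f _ hf hfi (spowJ x hx N) (πpow x)
      · change π (f * x * f) = π x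
        rw [hπ, hπ, πi f hfi, one_mul, mul_one]
    · intro x y hx hy hxy
      refine Prod.ext (Subtype.ext ?_) (Subtype.ext ?_)
      · exact powmul x hx y hy
      · exact hπ x y

end criterion

/-! ### The congruences -/

section cong
variable {A : Type}

open Classical in
/-- Split at the first occurrence. -/
noncomputable def fs (a : A) : List A → List A × List A
  | [] => ([], [])
  | b :: l => if b = a then ([], l) else (b :: (fs a l).1, (fs a l).2)

theorem fs_not_mem (a : A) (l : List A) (h : a ∉ l) : fs a l = (l, []) := by
  induction l with
  | nil => rfl
  | cons b l ih =>
    simp only [List.mem_cons, not_or] at h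
    simp only [fs, if_neg (Ne.symm h.1), ih h.2]

theorem fs_mem (a : A) (l : List A) (h : a ∈ l) :
    l = (fs a l).1 ++ a :: (fs a l).2 ∧ a ∉ (fs a l).1 := by
  induction l with
  | nil => simp at h
  | cons b l ih =>
    by_cases hb : b = a
    · subst hb; simp [fs]
    · have h' : a ∈ l := by simpa [Ne.symm hb] using h
      simp only [fs, if_neg hb, List.cons_append, List.mem_cons, not_or]
      exact ⟨by rw [← (ih h').1], Ne.symm hb, (ih h').2⟩

theorem fs_append_mem (a : A) (u w : List A) (h : a ∈ u) :
    fs a (u ++ w) = ((fs a u).1, (fs a u).2 ++ w) := by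
  induction u with
  | nil => simp at h
  | cons b l ih =>
    by_cases hb : b = a
    · subst hb; simp [fs]
    · have h' : a ∈ l := by simpa [Ne.symm hb] using h
      simp only [List.cons_append, fs, if_neg hb, ih h']

theorem fs_append_not_mem (a : A) (u w : List A) (h : a ∉ u) :
    fs a (u ++ w) = (u ++ (fs a w).1, (fs a w).2) := by
  induction u with
  | nil => rfl
  | cons b l ih =>
    simp only [List.mem_cons, not_or] at h
    simp only [List.cons_append, fs, if_neg (Ne.symm h.1), ih h.2]

/-- Split at the last occurrence. -/
noncomputable def ls (a : A) (l : List A) : List A × List A :=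
  ((fs a l.reverse).2.reverse, (fs a l.reverse).1.reverse)

theorem ls_mem (a : A) (l : List A) (h : a ∈ l) :
    l = (ls a l).1 ++ a :: (ls a l).2 ∧ a ∉ (ls a l).2 := by
  have h2 := fs_mem a l.reverse (by simpa using h)
  constructor
  · have := congrArg List.reverse h2.1
    simpa [ls] using this
  · simpa [ls] using h2.2

theorem ls_append_mem (a : A) (u w : List A) (h : a ∈ w) :
    ls a (u ++ w) = (u ++ (ls a w).1, (ls a w).2) := by
  simp only [ls, List.reverse_append]
  rw [fs_append_mem a _ _ (by simpa using h)]
  simp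

theorem ls_append_not_mem (a : A) (u w : List A) (h : a ∉ w) :
    ls a (u ++ w) = ((ls a u).1, (ls a u).2 ++ w) := by
  simp only [ls, List.reverse_append]
  rw [fs_append_not_mem a _ _ (by simpa using h)]
  simp

theorem ls_not_mem (a : A) (l : List A) (h : a ∉ l) : ls a l = ([], l) := by
  simp only [ls]
  rw [fs_not_mem a _ (by simpa using h)]
  simp

/-- Invariants of words. -/
def Inv (A : Type) (n : ℕ) : ℕ → Type
  | 0 => Set A × (A → ZMod n)
  | k + 1 => Inv A n k × (A → (Inv A n k × Inv A n k) × (Inv A n k × Inv A n k))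

theorem inv_finite [Finite A] (n : ℕ) [NeZero n] (k : ℕ) : Finite (Inv A n k) := by
  induction k with
  | zero => exact inferInstanceAs (Finite (Set A × (A → ZMod n)))
  | succ k ih =>
    exact inferInstanceAs
      (Finite (Inv A n k × (A → (Inv A n k × Inv A n k) × (Inv A n k × Inv A n k))))

/-- Commutative image modulo `n`. -/
noncomputable def pm (n : ℕ) (l : List A) : A → ZMod n := fun a => ((parikh l a : ℤ) : ZMod n)

theorem pm_append (n : ℕ) (l m : List A) : pm n (l ++ m) = pm n l + pm n m := by
  ext a; simp [pm, parikh_append]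

/-- The class of a word. -/
noncomputable def cls (n : ℕ) : (k : ℕ) → List A → Inv A n k
  | 0, l => ({a | a ∈ l}, pm n l)
  | k + 1, l => (cls n k l, fun a => ((cls n k (fs a l).1, cls n k (fs a l).2),
      (cls n k (ls a l).1, cls n k (ls a l).2)))

theorem cls_succ_iff {n k : ℕ} {u v : List A} : cls n (k + 1) u = cls n (k + 1) v ↔
    cls n k u = cls n k v ∧ ∀ a, (cls n k (fs a u).1 = cls n k (fs a v).1 ∧
      cls n k (fs a u).2 = cls n k (fs a v).2) ∧ (cls n k (ls a u).1 = cls n k (ls a v).1 ∧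
      cls n k (ls a u).2 = cls n k (ls a v).2) := by
  constructor
  · intro h
    refine ⟨congrArg (fun p : Inv A n k ×
      (A → (Inv A n k × Inv A n k) × (Inv A n k × Inv A n k)) => p.1) h, fun a => ⟨⟨?_, ?_⟩, ?_, ?_⟩⟩
    · exact congrArg (fun p : Inv A n k ×
        (A → (Inv A n k × Inv A n k) × (Inv A n k × Inv A n k)) => (p.2 a).1.1) h
    · exact congrArg (fun p : Inv A n k ×
        (A → (Inv A n k × Inv A n k) × (Inv A n k × Inv A n k)) => (p.2 a).1.2) h
    · exact congrArg (fun p : Inv A n k ×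
        (A → (Inv A n k × Inv A n k) × (Inv A n k × Inv A n k)) => (p.2 a).2.1) h
    · exact congrArg (fun p : Inv A n k ×
        (A → (Inv A n k × Inv A n k) × (Inv A n k × Inv A n k)) => (p.2 a).2.2) h
  · intro h
    exact Prod.ext h.1 (funext fun a => Prod.ext (Prod.ext (h.2 a).1.1 (h.2 a).1.2)
      (Prod.ext (h.2 a).2.1 (h.2 a).2.2))

theorem cls_zero_iff {n : ℕ} {u v : List A} : cls n 0 u = cls n 0 v ↔
    (∀ a, a ∈ u ↔ a ∈ v) ∧ pm n u = pm n v := by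
  constructor
  · intro h
    exact ⟨fun a => Set.ext_iff.1 (congrArg (fun p : Set A × (A → ZMod n) => p.1) h) a,
      congrArg (fun p : Set A × (A → ZMod n) => p.2) h⟩
  · intro h
    exact Prod.ext (Set.ext h.1) h.2

theorem cls_le {n j k : ℕ} (hjk : j ≤ k) {u v : List A} (h : cls n k u = cls n k v) :
    cls n j u = cls n j v := by
  induction k with
  | zero => obtain rfl : j = 0 := by omega
            exact h
  | succ k ih =>
    rcases Nat.lt_or_ge k j with h' | h'
    · obtain rfl : j = k + 1 := by omega
      exact h
    · exact ih h' (cls_succ_iff.1 h).1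

theorem cls_mem {n k : ℕ} {u v : List A} (h : cls n k u = cls n k v) (a : A) :
    a ∈ u ↔ a ∈ v := (cls_zero_iff.1 (cls_le (Nat.zero_le k) h)).1 a

theorem cls_pm {n k : ℕ} {u v : List A} (h : cls n k u = cls n k v) :
    pm n u = pm n v := (cls_zero_iff.1 (cls_le (Nat.zero_le k) h)).2

theorem cls_append_right {n k : ℕ} (w : List A) : ∀ {u v : List A}, cls n k u = cls n k v →
    cls n k (u ++ w) = cls n k (v ++ w) := by
  induction k generalizing w with
  | zero =>
    intro u v h
    rw [cls_zero_iff] at h ⊢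
    refine ⟨fun a => by simp [h.1 a], by rw [pm_append, pm_append, h.2]⟩
  | succ k ih =>
    intro u v h
    have hm := cls_mem h
    rw [cls_succ_iff] at h ⊢
    refine ⟨ih w h.1, fun a => ⟨?_, ?_⟩⟩
    · by_cases ha : a ∈ u
      · rw [fs_append_mem a u w ha, fs_append_mem a v w ((hm a).1 ha)]
        exact ⟨(h.2 a).1.1, ih w (h.2 a).1.2⟩
      · rw [fs_append_not_mem a u w ha, fs_append_not_mem a v w (fun h => ha ((hm a).2 h))]
        exact ⟨ih _ h.1, rfl⟩
    · by_cases ha : a ∈ w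
      · rw [ls_append_mem a u w ha, ls_append_mem a v w ha]
        exact ⟨ih _ h.1, rfl⟩
      · rw [ls_append_not_mem a u w ha, ls_append_not_mem a v w ha]
        exact ⟨(h.2 a).2.1, ih w (h.2 a).2.2⟩

theorem cls_append_left {n k : ℕ} (w : List A) : ∀ {u v : List A}, cls n k u = cls n k v →
    cls n k (w ++ u) = cls n k (w ++ v) := by
  induction k generalizing w with
  | zero =>
    intro u v h
    rw [cls_zero_iff] at h ⊢
    refine ⟨fun a => by simp [h.1 a], by rw [pm_append, pm_append, h.2]⟩
  | succ k ih =>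
    intro u v h
    have hm := cls_mem h
    rw [cls_succ_iff] at h ⊢
    refine ⟨ih w h.1, fun a => ⟨?_, ?_⟩⟩
    · by_cases ha : a ∈ w
      · rw [fs_append_mem a w u ha, fs_append_mem a w v ha]
        exact ⟨rfl, ih _ h.1⟩
      · rw [fs_append_not_mem a w u ha, fs_append_not_mem a w v ha]
        exact ⟨ih w (h.2 a).1.1, (h.2 a).1.2⟩
    · by_cases ha : a ∈ u
      · rw [ls_append_mem a w u ha, ls_append_mem a w v ((hm a).1 ha)]
        exact ⟨ih w (h.2 a).2.1, (h.2 a).2.2⟩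
      · rw [ls_append_not_mem a w u ha, ls_append_not_mem a w v (fun h => ha ((hm a).2 h))]
        exact ⟨rfl, ih _ h.1⟩

theorem cls_append {n k : ℕ} {u v u' v' : List A} (h : cls n k u = cls n k v)
    (hright : cls n k u' = cls n k v') : cls n k (u ++ u') = cls n k (v ++ v') :=
  (cls_append_right u' h).trans (cls_append_left v hright)

/-- Words over `E` from which one can split `k` times. -/
def Rich (E : Set A) : ℕ → List A → Prop
  | 0, u => ∀ a ∈ u, a ∈ E
  | k + 1, u => (∀ a ∈ u, a ∈ E) ∧ ∀ a ∈ E, a ∈ u ∧ Rich E k (fs a u).2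

theorem Rich.sub {E : Set A} {k : ℕ} {u : List A} (h : Rich E k u) : ∀ a ∈ u, a ∈ E := by
  cases k with
  | zero => exact h
  | succ k => exact h.1

theorem Rich.pred {E : Set A} {k : ℕ} : ∀ {u : List A}, Rich E (k + 1) u → Rich E k u := by
  induction k with
  | zero => intro u h; exact h.1
  | succ k ih => intro u h; exact ⟨h.1, fun a ha => ⟨(h.2 a ha).1, ih (h.2 a ha).2⟩⟩

/-- iterated concatenation -/
def lpow (l : List A) : ℕ → List A
  | 0 => []
  | k + 1 => l ++ lpow l k

theorem rich_lpow (E : List A) (k : ℕ) : ∀ j : List A, (∀ a ∈ j, a ∈ E) →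
    Rich {a | a ∈ E} k (j ++ lpow E k) := by
  have hl : ∀ k, ∀ a ∈ lpow E k, a ∈ E := by
    intro k
    induction k with
    | zero => intro a ha; simp [lpow] at ha
    | succ k ih =>
      intro a ha
      rcases List.mem_append.1 ha with h | h
      · exact h
      · exact ih a h
  induction k with
  | zero => intro j hj a ha; exact hj a (by simpa [lpow] using ha)
  | succ k ih =>
    intro j hj
    refine ⟨?_, ?_⟩
    · intro a ha
      rcases List.mem_append.1 ha with h | h
      · exact hj a h
      · exact hl _ a h
    · intro a ha
      refine ⟨List.mem_append.2 (Or.inr (List.mem_append.2 (Or.inl ha))), ?_⟩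
      by_cases haj : a ∈ j
      · rw [fs_append_mem a _ _ haj]
        have e1 : (fs a j).2 ++ lpow E (k + 1) = ((fs a j).2 ++ E) ++ lpow E k := by
          simp [lpow]
        change Rich _ k ((fs a j).2 ++ lpow E (k + 1))
        rw [e1]
        apply ih
        intro b hb
        rcases List.mem_append.1 hb with h | h
        · apply hj; rw [(fs_mem a j haj).1]; simp [h]
        · exact h
      · rw [fs_append_not_mem a _ _ haj]
        change Rich _ k (fs a (E ++ lpow E k)).2
        rw [fs_append_mem a _ _ ha]
        apply ih
        intro b hb
        rw [(fs_mem a E ha).1]; simp [hb]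

theorem rich_swap {n : ℕ} {E : Set A} (x y : List A) (hx : ∀ a ∈ x, a ∈ E) (hy : ∀ a ∈ y, a ∈ E)
    (hxy : pm n x = pm n y) (k : ℕ) : ∀ u v : List A, Rich E (k + 1) u → Rich E (k + 1) v.reverse →
      cls n k (u ++ x ++ v) = cls n k (u ++ y ++ v) := by
  induction k with
  | zero =>
    intro u v hu hv
    rw [cls_zero_iff]
    refine ⟨fun a => ?_, by simp only [pm_append, hxy]⟩
    simp only [List.mem_append]
    have h1 := hu.sub a
    have h2 := fun h => (hu.2 a h).1
    have h3 := hx a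
    have h4 := hy a
    tauto
  | succ k ih =>
    intro u v hu hv
    have h0 := ih u v hu.pred hv.pred
    rw [cls_succ_iff]
    refine ⟨h0, fun a => ?_⟩
    by_cases ha : a ∈ E
    · have hau := (hu.2 a ha).1
      have hav : a ∈ v := by simpa using (hv.2 a ha).1
      refine ⟨?_, ?_⟩
      · rw [List.append_assoc, List.append_assoc, fs_append_mem a _ _ hau, fs_append_mem a _ _ hau]
        refine ⟨rfl, ?_⟩
        have := ih (fs a u).2 v (hu.2 a ha).2 hv.pred
        simpa only [List.append_assoc] using this
      · rw [ls_append_mem a _ _ hav, ls_append_mem a _ _ hav]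
        refine ⟨?_, rfl⟩
        refine ih u (ls a v).1 hu.pred ?_
        have := (hv.2 a ha).2
        simpa [ls] using this
    · have hu' : a ∉ u := fun h => ha (hu.sub a h)
      have hv' : a ∉ v := fun h => ha (hv.sub a (by simpa using h))
      have n1 : a ∉ u ++ x ++ v := by
        simp only [List.mem_append]; have := hx a; tauto
      have n2 : a ∉ u ++ y ++ v := by
        simp only [List.mem_append]; have := hy a; tauto
      rw [fs_not_mem a _ n1, fs_not_mem a _ n2, ls_not_mem a _ n1, ls_not_mem a _ n2]
      exact ⟨⟨h0, rfl⟩, ⟨rfl, h0⟩⟩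

theorem lpow_comm (l : List A) (k : ℕ) : l ++ lpow l k = lpow l k ++ l := by
  induction k with
  | zero => simp [lpow]
  | succ k ih => simp only [lpow, List.append_assoc, ← ih]

theorem lpow_reverse (l : List A) (k : ℕ) : (lpow l k).reverse = lpow l.reverse k := by
  induction k with
  | zero => rfl
  | succ k ih => rw [lpow, lpow_comm, List.reverse_append, ih]; rfl

theorem cls_lpow {n k : ℕ} {l : List A} (h : cls n k (l ++ l) = cls n k l) (m : ℕ) :
    cls n k (lpow l (m + 1)) = cls n k l := by
  induction m with
  | zero => simp [lpow]
  | succ m ih => exact (cls_append_left l ih).trans h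

theorem cls_swap {n k : ℕ} {l x y : List A} (h : cls n k (l ++ l) = cls n k l)
    (hx : ∀ a ∈ x, a ∈ l) (hy : ∀ a ∈ y, a ∈ l) (hxy : pm n x = pm n y) :
    cls n k (l ++ x ++ l) = cls n k (l ++ y ++ l) := by
  have h1 : ∀ z, cls n k (l ++ z ++ l) = cls n k (lpow l (k + 1) ++ z ++ lpow l (k + 1)) := by
    intro z
    exact cls_append (cls_append (cls_lpow h k).symm rfl) (cls_lpow h k).symm
  rw [h1, h1]
  apply rich_swap (E := {a | a ∈ l}) x y hx hy hxy
  · have := rich_lpow l (k + 1) [] (by simp)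
    simpa using this
  · have := rich_lpow l.reverse (k + 1) [] (by simp)
    rw [lpow_reverse]
    simpa using this

/-- The list of letters of an element of the free semigroup. -/
def toL (x : FreeSemigroup A) : List A := x.head :: x.tail

theorem toL_mul (x y : FreeSemigroup A) : toL (x * y) = toL x ++ toL y := by
  simp [toL]

/-- The congruence of level `k`. -/
def conK (A : Type) (n k : ℕ) : Con (FreeSemigroup A) where
  r x y := cls n k (toL x) = cls n k (toL y)
  iseqv := ⟨fun _ => rfl, fun h => h.symm, fun h h' => h.trans h'⟩
  mul' := by
    intro a b c d h h'
    change cls n k (toL (a * c)) = cls n k (toL (b * d))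
    rw [toL_mul, toL_mul]
    exact cls_append h h'

theorem conK_finite [Finite A] (n : ℕ) [NeZero n] (k : ℕ) : Finite (conK A n k).Quotient := by
  have := inv_finite (A := A) n k
  refine Finite.of_injective
    (fun q : (conK A n k).Quotient => Con.liftOn q (fun x => cls n k (toL x)) (fun _ _ h => h)) ?_
  intro p q
  induction p using Con.induction_on
  induction q using Con.induction_on
  intro h
  exact (Con.eq _).2 h

theorem conK_inDOAb (N k : ℕ) : InDOAb (conK A (N + 1) k).Quotient := by
  let π : (conK A (N + 1) k).Quotient → Multiplicative (A → ZMod (N + 1)) :=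
    fun q => Con.liftOn q (fun x => Multiplicative.ofAdd (pm (N + 1) (toL x)))
      (fun _ _ h => congrArg Multiplicative.ofAdd (cls_pm h))
  let c : (conK A (N + 1) k).Quotient → Set A :=
    fun q => Con.liftOn q (fun x => {a | a ∈ toL x}) (fun _ _ h => Set.ext (cls_mem h))
  refine inDOAb_of π ?_ N ?_ c ?_ ?_
  · intro x y
    induction x using Con.induction_on with | _ x => ?_
    induction y using Con.induction_on with | _ y => ?_
    change Multiplicative.ofAdd (pm (N + 1) (toL (x * y))) = _
    rw [toL_mul, pm_append]
    rfl
  · intro g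
    induction g using Multiplicative.rec with | _ g => ?_
    rw [← ofAdd_nsmul, ← ofAdd_zero]
    congr 1
    ext a
    simp only [Pi.smul_apply, nsmul_eq_mul, Pi.zero_apply, Pi.mul_apply]
    have : ((N + 1 : ℕ) : ZMod (N + 1)) = 0 := ZMod.natCast_self (N + 1)
    simp [this]
  · intro x y
    induction x using Con.induction_on with | _ x => ?_
    induction y using Con.induction_on with | _ y => ?_
    change {a | a ∈ toL (x * y)} = {a | a ∈ toL x} ∪ {a | a ∈ toL y}
    rw [toL_mul]
    ext a
    simp
  · intro e x y
    induction e using Con.induction_on with | _ e => ?_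
    induction x using Con.induction_on with | _ x => ?_
    induction y using Con.induction_on with | _ y => ?_
    intro he hx hy hxy
    have he' : ((e * e : FreeSemigroup A) : (conK A (N + 1) k).Quotient) = e := he
    have he2 : cls (N + 1) k (toL (e * e)) = cls (N + 1) k (toL e) := (Con.eq _).1 he'
    rw [toL_mul] at he2
    have := cls_swap he2 hx hy (Multiplicative.ofAdd.injective hxy)
    change ((e * x * e : FreeSemigroup A) : (conK A (N + 1) k).Quotient) =
      ((e * y * e : FreeSemigroup A) : (conK A (N + 1) k).Quotient)
    refine (Con.eq _).2 ?_
    change cls (N + 1) k (toL (e * x * e)) = cls (N + 1) k (toL (e * y * e))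
    simpa only [toL_mul] using this

end cong



/-! ### The main induction -/

section main
variable {A S I : Type} [Semigroup S]

/-- All words in the family have the same class. -/
def Agree (n k : ℕ) (W : I → List A) : Prop := ∀ i j, cls n k (W i) = cls n k (W j)

/-- All words in the family have content `B`. -/
def HasC (W : I → List A) (B : Set A) : Prop := ∀ i a, a ∈ W i ↔ a ∈ B

theorem Agree.le {n j k : ℕ} {W : I → List A} (h : Agree n k W) (hjk : j ≤ k) : Agree n j W :=
  fun i i' => cls_le hjk (h i i')

theorem exists_hasC [Nonempty I] {n k : ℕ} {W : I → List A} (h : Agree n k W) :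
    ∃ B, HasC W B := by
  obtain ⟨i0⟩ := ‹Nonempty I›
  exact ⟨{a | a ∈ W i0}, fun i a => cls_mem (h i i0) a⟩

theorem exists_last_first (l : List A) (hl : l ≠ []) :
    ∃ a ∈ l, ∀ b ∈ l, b ≠ a → b ∈ (fs a l).1 := by
  induction l using List.reverseRecOn with
  | nil => exact absurd rfl hl
  | append_singleton l c ih =>
    by_cases hc : c ∈ l
    · obtain ⟨a, ha, h⟩ := ih (List.ne_nil_of_mem hc)
      refine ⟨a, List.mem_append.2 (Or.inl ha), ?_⟩
      rw [fs_append_mem a l _ ha]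
      intro b hb hba
      refine h b ?_ hba
      rcases List.mem_append.1 hb with h' | h'
      · exact h'
      · rw [List.mem_singleton.1 h']; exact hc
    · refine ⟨c, by simp, ?_⟩
      rw [fs_append_not_mem c l _ hc]
      intro b hb hba
      refine List.mem_append.2 (Or.inl ?_)
      rcases List.mem_append.1 hb with h' | h'
      · exact h'
      · exact absurd (List.mem_singleton.1 h') hba

theorem exists_first_last (l : List A) (hl : l ≠ []) :
    ∃ a ∈ l, ∀ b ∈ l, b ≠ a → b ∈ (ls a l).2 := by
  obtain ⟨a, ha, h⟩ := exists_last_first l.reverse (by simpa using hl)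
  refine ⟨a, by simpa using ha, fun b hb hba => ?_⟩
  have := h b (by simpa using hb) hba
  simpa [ls] using this

theorem left_block [Nonempty I] {n k : ℕ} {W : I → List A} {B : Set A} (hW : Agree n (k + 1) W)
    (hB : HasC W B) (hne : B.Nonempty) : ∃ a ∈ B, ∃ U V : I → List A,
      (∀ i, W i = U i ++ [a] ++ V i) ∧ Agree n k U ∧ Agree n k V ∧ HasC U (B \ {a}) := by
  obtain ⟨i0⟩ := ‹Nonempty I›
  obtain ⟨c, hc⟩ := hne
  obtain ⟨a, ha, h⟩ := exists_last_first (W i0) (List.ne_nil_of_mem ((hB i0 c).2 hc))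
  have haB := (hB i0 a).1 ha
  have hU : Agree n k (fun i => (fs a (W i)).1) := fun i j =>
    ((cls_succ_iff.1 (hW i j)).2 a).1.1
  refine ⟨a, haB, fun i => (fs a (W i)).1, fun i => (fs a (W i)).2, ?_, hU, ?_, ?_⟩
  · intro i
    have := (fs_mem a (W i) ((hB i a).2 haB)).1
    simpa using this
  · exact fun i j => ((cls_succ_iff.1 (hW i j)).2 a).1.2
  · intro i b
    rw [cls_mem (hU i i0) b]
    have hm := fs_mem a (W i0) ha
    constructor
    · intro hb
      refine ⟨(hB i0 b).1 ?_, ?_⟩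
      · rw [hm.1]; exact List.mem_append.2 (Or.inl hb)
      · rintro rfl; exact hm.2 hb
    · rintro ⟨hb, hba⟩
      exact h b ((hB i0 b).2 hb) hba

theorem right_block [Nonempty I] {n k : ℕ} {W : I → List A} {B : Set A} (hW : Agree n (k + 1) W)
    (hB : HasC W B) (hne : B.Nonempty) : ∃ a ∈ B, ∃ U V : I → List A,
      (∀ i, W i = V i ++ ([a] ++ U i)) ∧ Agree n k U ∧ Agree n k V ∧ HasC U (B \ {a}) := by
  obtain ⟨i0⟩ := ‹Nonempty I›
  obtain ⟨c, hc⟩ := hne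
  obtain ⟨a, ha, h⟩ := exists_first_last (W i0) (List.ne_nil_of_mem ((hB i0 c).2 hc))
  have haB := (hB i0 a).1 ha
  have hU : Agree n k (fun i => (ls a (W i)).2) := fun i j =>
    ((cls_succ_iff.1 (hW i j)).2 a).2.2
  refine ⟨a, haB, fun i => (ls a (W i)).2, fun i => (ls a (W i)).1, ?_, hU, ?_, ?_⟩
  · intro i
    have := (ls_mem a (W i) ((hB i a).2 haB)).1
    simpa using this
  · exact fun i j => ((cls_succ_iff.1 (hW i j)).2 a).2.1
  · intro i b
    rw [cls_mem (hU i i0) b]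
    have hm := ls_mem a (W i0) ha
    constructor
    · intro hb
      refine ⟨(hB i0 b).1 ?_, ?_⟩
      · rw [hm.1]; exact List.mem_append.2 (Or.inr (List.mem_cons_of_mem _ hb))
      · rintro rfl; exact hm.2 hb
    · rintro ⟨hb, hba⟩
      exact h b ((hB i0 b).2 hb) hba

/-- Families of words over `B` with constant commutative image. -/
def WB (n : ℕ) (B : Set A) (x : I → List A) : Prop :=
  (∀ i j, pm n (x i) = pm n (x j)) ∧ ∀ i, ∀ a ∈ x i, a ∈ B

theorem WB.append {n : ℕ} {B : Set A} {x y : I → List A} (hx : WB n B x) (hy : WB n B y) :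
    WB n B (fun i => x i ++ y i) := by
  refine ⟨fun i j => by rw [pm_append, pm_append, hx.1 i j, hy.1 i j], fun i a ha => ?_⟩
  rcases List.mem_append.1 ha with h | h
  · exact hx.2 i a h
  · exact hy.2 i a h

theorem WB_of {n k : ℕ} {B C : Set A} {x : I → List A} (hx : Agree n k x) (hC : HasC x C)
    (h : C ⊆ B) : WB n B x :=
  ⟨fun i j => cls_pm (hx i j), fun i a ha => h ((hC i a).1 ha)⟩

/-- Concatenation of a list of families of words. -/
def cat (bl : List (I → List A)) : I → List A := fun i => (bl.map (· i)).flatten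

theorem cat_append (l m : List (I → List A)) (i : I) : cat (l ++ m) i = cat l i ++ cat m i := by
  simp [cat]

theorem cat_cons (x : I → List A) (m : List (I → List A)) (i : I) :
    cat (x :: m) i = x i ++ cat m i := by
  simp [cat]

theorem cat_nil (i : I) : cat ([] : List (I → List A)) i = [] := rfl

theorem cat_single (x : I → List A) (i : I) : cat [x] i = x i := by simp [cat]

/-- The word-value tuple. -/
def evt (σ : A → S) (x : I → List A) : I → WithOne S := fun i => ev σ (x i)

theorem evt_append (σ : A → S) (x y : I → List A) :
    evt σ (fun i => x i ++ y i) = evt σ x * evt σ y := funext fun _ => ev_append _ _ _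

/-- Blocks. -/
def Blk (n : ℕ) (σ : A → S) (B : Set A) (x : I → List A) : Prop :=
  KP σ B (evt σ x) ∧ WB n B x

theorem Blk.append {n : ℕ} {σ : A → S} {B : Set A} {x y : I → List A} (hx : Blk n σ B x)
    (hy : Blk n σ B y) : Blk n σ B (fun i => x i ++ y i) := by
  refine ⟨?_, hx.2.append hy.2⟩
  have := hx.1.mul hy.1
  rwa [Set.union_self, ← evt_append] at this

theorem WB_cat {n : ℕ} {σ : A → S} {B : Set A} (l : List (I → List A))
    (h : ∀ x ∈ l, Blk n σ B x) : WB n B (cat l) := by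
  induction l with
  | nil => exact ⟨fun i j => rfl, fun i a ha => by simp [cat_nil] at ha⟩
  | cons x l ih =>
    have h1 := (h x (by simp)).2.append (ih fun y hy => h y (by simp [hy]))
    have : cat (x :: l) = fun i => x i ++ cat l i := funext fun i => cat_cons x l i
    rwa [this]

theorem Blk_cat {n : ℕ} {σ : A → S} {B : Set A} (l : List (I → List A)) (hl : l ≠ [])
    (h : ∀ x ∈ l, Blk n σ B x) : Blk n σ B (cat l) := by
  induction l with
  | nil => exact absurd rfl hl
  | cons x l ih =>
    by_cases hn : l = []
    · subst hn
      have : cat [x] = x := funext fun i => cat_single x i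
      rw [this]
      exact h x (by simp)
    · have h1 := (h x (by simp)).append (ih hn fun y hy => h y (by simp [hy]))
      have : cat (x :: l) = fun i => x i ++ cat l i := funext fun i => cat_cons x l i
      rwa [this]

theorem pig_left [Finite S] [Finite I] {n : ℕ} {σ : A → S} {B : Set A} (bl : List (I → List A))
    (hlen : bl.length = Nat.card (I → WithOne S) + 1) (h : ∀ x ∈ bl, Blk n σ B x) :
    ∃ P F R : I → List A, Blk n σ B P ∧ Blk n σ B F ∧ WB n B R ∧
      (∀ i, cat bl i = P i ++ (F i ++ R i)) ∧ evt σ P * evt σ F = evt σ P := by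
  have : Finite (WithOne S) := inferInstanceAs (Finite (Option S))
  obtain ⟨x, bl, rfl⟩ : ∃ x l, bl = x :: l := by
    cases bl with
    | nil => simp at hlen
    | cons x l => exact ⟨x, l, rfl⟩
  obtain ⟨l1, l2, l3, rfl, h2, hF⟩ := pigeon (fun l => evt σ (cat (x :: l))) bl
    (by simp at hlen; omega)
  refine ⟨cat (x :: l1), cat l2, cat l3, Blk_cat _ (by simp) ?_, Blk_cat _ h2 ?_, WB_cat (σ := σ) _ ?_,
    ?_, ?_⟩
  · intro y hy
    apply h
    simp only [List.mem_cons, List.mem_append] at hy ⊢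
    tauto
  · intro y hy
    apply h
    simp only [List.mem_cons, List.mem_append] at hy ⊢
    tauto
  · intro y hy
    apply h
    simp only [List.mem_cons, List.mem_append] at hy ⊢
    tauto
  · intro i
    simp only [cat_cons, cat_append, List.append_assoc]
  · rw [← evt_append]
    have e : (fun i => cat (x :: l1) i ++ cat l2 i) = cat (x :: (l1 ++ l2)) := by
      funext i
      simp only [cat_cons, cat_append, List.append_assoc]
    rw [e]
    exact hF.symm

theorem pig_right [Finite S] [Finite I] {n : ℕ} {σ : A → S} {B : Set A} (bl : List (I → List A))
    (hlen : bl.length = Nat.card (I → WithOne S) + 1) (h : ∀ x ∈ bl, Blk n σ B x) :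
    ∃ P F R : I → List A, Blk n σ B P ∧ Blk n σ B F ∧ WB n B R ∧
      (∀ i, cat bl i = R i ++ (F i ++ P i)) ∧ evt σ F * evt σ P = evt σ P := by
  have : Finite (WithOne S) := inferInstanceAs (Finite (Option S))
  obtain ⟨x, bl, rfl⟩ : ∃ x l, bl = List.reverse (x :: l) := by
    rcases hr : bl.reverse with _ | ⟨x, l⟩
    · simp at hr; simp [hr] at hlen
    · exact ⟨x, l, by rw [← hr, List.reverse_reverse]⟩
  obtain ⟨l1, l2, l3, rfl, h2, hF⟩ := pigeon (fun l => evt σ (cat (List.reverse (x :: l)))) bl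
    (by simp at hlen; omega)
  refine ⟨cat (List.reverse (x :: l1)), cat l2.reverse, cat l3.reverse, Blk_cat _ (by simp) ?_,
    Blk_cat _ (by simpa using h2) ?_, WB_cat (σ := σ) _ ?_, ?_, ?_⟩
  · intro y hy
    apply h
    simp only [List.mem_reverse, List.mem_cons, List.mem_append] at hy ⊢
    tauto
  · intro y hy
    apply h
    simp only [List.mem_reverse, List.mem_cons, List.mem_append] at hy ⊢
    tauto
  · intro y hy
    apply h
    simp only [List.mem_reverse, List.mem_cons, List.mem_append] at hy ⊢
    tauto
  · intro i
    simp only [List.reverse_cons, List.reverse_append, cat_append, List.append_assoc]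
  · rw [← evt_append]
    have e : (fun i => cat l2.reverse i ++ cat (List.reverse (x :: l1)) i) =
        cat (List.reverse (x :: (l1 ++ l2))) := by
      funext i
      simp only [List.reverse_cons, List.reverse_append, cat_append, List.append_assoc]
    rw [e]
    exact hF.symm

theorem left_D [Finite A] [Nonempty I] {n kb b : ℕ} {σ : A → S} {B : Set A}
    (hcard : B.ncard ≤ b + 1) (hne : B.Nonempty)
    (IH : ∀ C : Set A, C.ncard ≤ b → ∀ W : I → List A, Agree n kb W → HasC W C →
      KP σ C (evt σ W)) (k : ℕ) (hk : kb ≤ k) (m : ℕ) :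
    ∀ (W : I → List A) (C : Set A), Agree n (k + m) W → HasC W C → C ⊆ B →
      KP σ C (evt σ W) ∨ ∃ (bl : List (I → List A)) (Z : I → List A) (D : Set A),
        bl.length = m ∧ (∀ x ∈ bl, Blk n σ B x) ∧ (∀ i, W i = cat bl i ++ Z i) ∧
        Agree n k Z ∧ HasC Z D ∧ D ⊆ B := by
  induction m with
  | zero =>
    intro W C hW hC hCB
    exact Or.inr ⟨[], W, C, rfl, by simp, fun i => rfl, hW, hC, hCB⟩
  | succ m ih =>
    intro W C hW hC hCB
    by_cases hlt : C.ncard ≤ b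
    · exact Or.inl (IH C hlt W (hW.le (by omega)) hC)
    obtain rfl : C = B := Set.eq_of_subset_of_ncard_le hCB (by omega) (Set.toFinite B)
    obtain ⟨a, ha, U, V, hWUV, hU, hV, hUC⟩ := left_block (k := k + m) hW hC hne
    have hd : (C \ {a}).ncard ≤ b := by
      have := Set.ncard_diff_singleton_lt_of_mem ha (Set.toFinite C)
      omega
    have hb1 : Blk n σ C (fun i => U i ++ [a]) := by
      refine ⟨?_, (WB_of hU hUC Set.diff_subset).append ⟨fun i j => rfl, ?_⟩⟩
      · have h1 := (IH _ hd U (hU.le (by omega)) hUC).mul (KP_letter (I := I) σ a)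
        rw [Set.diff_union_self, Set.union_eq_left.2 (Set.singleton_subset_iff.2 ha)] at h1
        rw [evt_append]
        have e : evt σ (fun _ : I => [a]) = fun _ => (σ a : WithOne S) :=
          funext fun _ => ev_singleton σ a
        rwa [e]
      · intro i b hb
        rw [List.mem_singleton.1 hb]; exact ha
    obtain ⟨D, hD⟩ := exists_hasC hV
    have hDB : D ⊆ C := by
      intro d hd
      obtain ⟨i0⟩ := ‹Nonempty I›
      rw [← hC i0, hWUV i0]
      exact List.mem_append.2 (Or.inr ((hD i0 d).2 hd))
    rcases ih V D hV hD hDB with h | ⟨bl, Z, D', h1, h2, h3, h4, h5, h6⟩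
    · left
      have := hb1.1.mul h
      rw [← evt_append, Set.union_eq_left.2 hDB] at this
      have e : W = fun i => U i ++ [a] ++ V i := funext hWUV
      rwa [e]
    · right
      refine ⟨(fun i => U i ++ [a]) :: bl, Z, D', by simp [h1], ?_, ?_, h4, h5, h6⟩
      · intro x hx
        rcases List.mem_cons.1 hx with rfl | hx
        · exact hb1
        · exact h2 x hx
      · intro i
        rw [cat_cons, hWUV i, h3 i]
        simp only [List.append_assoc]

theorem right_D [Finite A] [Nonempty I] {n kb b : ℕ} {σ : A → S} {B : Set A}
    (hcard : B.ncard ≤ b + 1) (hne : B.Nonempty)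
    (IH : ∀ C : Set A, C.ncard ≤ b → ∀ W : I → List A, Agree n kb W → HasC W C →
      KP σ C (evt σ W)) (k : ℕ) (hk : kb ≤ k) (m : ℕ) :
    ∀ (W : I → List A) (C : Set A), Agree n (k + m) W → HasC W C → C ⊆ B →
      KP σ C (evt σ W) ∨ ∃ (bl : List (I → List A)) (Z : I → List A) (D : Set A),
        bl.length = m ∧ (∀ x ∈ bl, Blk n σ B x) ∧ (∀ i, W i = Z i ++ cat bl i) ∧
        Agree n k Z ∧ HasC Z D ∧ D ⊆ B := by
  induction m with
  | zero =>
    intro W C hW hC hCB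
    exact Or.inr ⟨[], W, C, rfl, by simp, fun i => by simp [cat_nil], hW, hC, hCB⟩
  | succ m ih =>
    intro W C hW hC hCB
    by_cases hlt : C.ncard ≤ b
    · exact Or.inl (IH C hlt W (hW.le (by omega)) hC)
    obtain rfl : C = B := Set.eq_of_subset_of_ncard_le hCB (by omega) (Set.toFinite B)
    obtain ⟨a, ha, U, V, hWUV, hU, hV, hUC⟩ := right_block (k := k + m) hW hC hne
    have hd : (C \ {a}).ncard ≤ b := by
      have := Set.ncard_diff_singleton_lt_of_mem ha (Set.toFinite C)
      omega
    have hb1 : Blk n σ C (fun i => [a] ++ U i) := by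
      refine ⟨?_, WB.append ⟨fun i j => rfl, ?_⟩ (WB_of hU hUC Set.diff_subset)⟩
      · have h1 := (KP_letter (I := I) σ a).mul (IH _ hd U (hU.le (by omega)) hUC)
        rw [Set.union_diff_self, Set.union_eq_right.2 (Set.singleton_subset_iff.2 ha)] at h1
        rw [evt_append]
        have e : evt σ (fun _ : I => [a]) = fun _ => (σ a : WithOne S) :=
          funext fun _ => ev_singleton σ a
        rwa [e]
      · intro i b hb
        rw [List.mem_singleton.1 hb]; exact ha
    obtain ⟨D, hD⟩ := exists_hasC hV
    have hDB : D ⊆ C := by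
      intro d hd
      obtain ⟨i0⟩ := ‹Nonempty I›
      rw [← hC i0, hWUV i0]
      exact List.mem_append.2 (Or.inl ((hD i0 d).2 hd))
    rcases ih V D hV hD hDB with h | ⟨bl, Z, D', h1, h2, h3, h4, h5, h6⟩
    · left
      have := h.mul hb1.1
      rw [← evt_append, Set.union_eq_right.2 hDB] at this
      have e : W = fun i => V i ++ ([a] ++ U i) := funext hWUV
      rwa [e]
    · right
      refine ⟨bl ++ [fun i => [a] ++ U i], Z, D', by simp [h1], ?_, ?_, h4, h5, h6⟩
      · intro x hx
        rcases List.mem_append.1 hx with hx | hx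
        · exact h2 x hx
        · rw [List.mem_singleton.1 hx]; exact hb1
      · intro i
        rw [cat_append, cat_single, hWUV i, h3 i]
        simp only [List.append_assoc]

theorem main_claim [Finite A] [Finite S] [Finite I] [Nonempty I] {σ : A → S} {n : ℕ}
    (hn : ∀ (B : Set A) (z : I → List A), (∀ i, z i ≠ []) →
      (∀ i, ∀ a ∈ z i, a ∈ B) →
      (∀ i j a, ((parikh (z i) a : ℤ) : ZMod n) = ((parikh (z j) a : ℤ) : ZMod n)) →
      ∃ (τ : I → KTerm A) (s : I → S), (∀ i, KEval σ (τ i) (s i)) ∧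
        (∀ i, content (τ i) ⊆ B) ∧ (∀ i, ev σ (z i) = (s i : WithOne S)) ∧
        (∀ i j, ab (τ i) = ab (τ j))) (b : ℕ) :
    ∃ k, ∀ B : Set A, B.ncard ≤ b → ∀ W : I → List A, Agree n k W → HasC W B →
      KP σ B (evt σ W) := by
  have hempty : ∀ W : I → List A, HasC W ∅ → KP σ ∅ (evt σ W) := by
    intro W h
    refine Or.inl ⟨rfl, funext fun i => ?_⟩
    have : W i = [] := List.eq_nil_iff_forall_not_mem.2 fun a ha => (h i a).1 ha
    simp only [evt, this]
    rfl
  induction b with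
  | zero =>
    refine ⟨0, fun B hB W hW hC => ?_⟩
    obtain rfl : B = ∅ := (Set.ncard_eq_zero (Set.toFinite B)).1 (by omega)
    exact hempty W hC
  | succ b ihb =>
    obtain ⟨kb, IH⟩ := ihb
    refine ⟨kb + (Nat.card (I → WithOne S) + 1) + (Nat.card (I → WithOne S) + 1),
      fun B hB W hW hC => ?_⟩
    rcases B.eq_empty_or_nonempty with rfl | hne
    · exact hempty W hC
    rcases left_D hB hne IH _ (by omega) _ W B hW hC le_rfl with
      h | ⟨bl, Z, D, l1, l2, l3, l4, l5, l6⟩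
    · exact h
    have eW : evt σ W = evt σ (cat bl) * evt σ Z := by
      rw [← evt_append]; congr 1; exact funext l3
    rcases right_D hB hne IH _ le_rfl _ Z D l4 l5 l6 with
      h | ⟨br, Y, D', r1, r2, r3, r4, r5, r6⟩
    · have hbl : bl ≠ [] := by rintro rfl; simp at l1
      have := (Blk_cat bl hbl l2).1.mul h
      rwa [← eW, Set.union_eq_left.2 l6] at this
    obtain ⟨P, F, R, hP, hF, hR, hPFR, hPF⟩ := pig_left bl l1 l2
    obtain ⟨Q, F', R', hQ, hF', hR', hQFR, hFQ⟩ := pig_right br r1 r2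
    have hY : WB n B Y := WB_of r4 r5 r6
    let z : I → List A := fun i => F i ++ (R i ++ (Y i ++ (R' i ++ F' i)))
    have hz : WB n B z := hF.2.append (hR.append (hY.append (hR'.append hF'.2)))
    have hzne : ∀ i, z i ≠ [] := by
      intro i h
      have hFi : F i = [] := (List.append_eq_nil_iff.1 h).1
      rcases hF.1 with ⟨h0, -⟩ | ⟨t, s, h1, -⟩
      · exact hne.ne_empty h0
      · have h1i := h1 i
        simp only [evt, hFi, ev_nil] at h1i
        exact WithOne.one_ne_coe h1i
    obtain ⟨τ, s, t1, t2, t3, t4⟩ := hn B z hzne hz.2 (fun i j a => congrFun (hz.1 i j) a)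
    have := KP_sandwich hne hP.1 hF.1 hF'.1 hQ.1 hPF hFQ τ s t1 t2 t4
    have e : evt σ W = evt σ P * (fun i => (s i : WithOne S)) * evt σ Q := by
      have e1 : (fun i => (s i : WithOne S)) = evt σ z := funext fun i => (t3 i).symm
      rw [e1, ← evt_append, ← evt_append]
      congr 1
      funext i
      rw [l3 i, hPFR i, r3 i, hQFR i]
      simp only [z, List.append_assoc]
    rwa [e]

end main

section final
variable {A S : Type} [Semigroup S]

theorem ev_toL (φ : FreeSemigroup A →ₙ* S) (x : FreeSemigroup A) :
    ev (fun a => φ (FreeSemigroup.of a)) (toL x) = (φ x : WithOne S) := by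
  induction x using FreeSemigroup.recOnMul with
  | ih1 a => exact ev_singleton _ a
  | ih2 a y h1 h2 => rw [toL_mul, ev_append, h1, h2, map_mul, WithOne.coe_mul]

theorem final_nonempty [Finite S] (P : Set S) (hne : P.Nonempty) (hP : IsDOAbPointlike P)
    [Finite A] (φ : FreeSemigroup A →ₙ* S) (hφ : Function.Surjective φ) :
    ∃ w : P → KTerm A,
      (∀ p : P, KEval (fun a => φ (FreeSemigroup.of a)) (w p) (p : S)) ∧ VEq w := by
  have : Nonempty P := hne.to_subtype
  obtain ⟨n, hn0, hn⟩ := abelian_main (I := P) (fun a => φ (FreeSemigroup.of a))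
  obtain ⟨N, rfl⟩ : ∃ N, n = N + 1 := ⟨n - 1, by omega⟩
  obtain ⟨k, hk⟩ := main_claim hn (Nat.card A)
  have := conK_finite (A := A) (N + 1) k
  let R : Subsemigroup (S × (conK A (N + 1) k).Quotient) :=
    { carrier := {q | ∃ x : FreeSemigroup A, q = (φ x, (x : (conK A (N + 1) k).Quotient))}
      mul_mem' := by
        rintro _ _ ⟨x, rfl⟩ ⟨y, rfl⟩
        exact ⟨x * y, by rw [map_mul]; rfl⟩ }
  obtain ⟨t, ht⟩ := hP _ (conK_inDOAb N k) R (fun s => by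
    obtain ⟨x, rfl⟩ := hφ s
    exact ⟨_, x, rfl⟩)
  choose x hx using fun p : P => ht p p.2
  have hag : Agree (N + 1) k (fun p => toL (x p)) := by
    intro p q
    have e1 := congrArg Prod.snd (hx p)
    have e2 := congrArg Prod.snd (hx q)
    exact (Con.eq (conK A (N + 1) k)).1 (e1.symm.trans e2)
  obtain ⟨B, hB⟩ := exists_hasC hag
  have hev : ∀ p, evt (fun a => φ (FreeSemigroup.of a)) (fun p => toL (x p)) p = ((p : S) : WithOne S) := by
    intro p
    have e1 : (p : S) = φ (x p) := congrArg Prod.fst (hx p)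
    rw [e1]
    exact ev_toL φ (x p)
  have hBc : B.ncard ≤ Nat.card A := by
    rw [← Set.ncard_univ]
    exact Set.ncard_le_ncard (Set.subset_univ _) (Set.toFinite _)
  rcases hk B hBc _ hag hB with ⟨-, h⟩ | ⟨w, s, h1, h2, h3, h4⟩
  · obtain ⟨p⟩ := ‹Nonempty P›
    have := hev p
    rw [h] at this
    exact absurd this WithOne.one_ne_coe
  · refine ⟨w, fun p => ?_, h4⟩
    have e : (p : S) = s p := WithOne.coe_injective ((hev p).symm.trans (h1 p))
    rw [e]
    exact h2 p

theorem final_all [Finite S] (P : Set S) (hP : IsDOAbPointlike P)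
    [Finite A] (φ : FreeSemigroup A →ₙ* S) (hφ : Function.Surjective φ) :
    ∃ w : P → KTerm A,
      (∀ p : P, KEval (fun a => φ (FreeSemigroup.of a)) (w p) (p : S)) ∧ VEq w := by
  rcases P.eq_empty_or_nonempty with rfl | hne
  · have hA : Nonempty A := by
      by_contra hA
      have hS : ∀ s : S, False := fun s => by
        obtain ⟨x, -⟩ := hφ s
        exact hA ⟨x.head⟩
      let iE : Semigroup Empty := { mul := fun x _ => x, mul_assoc := fun x => x.elim }
      obtain ⟨t, -⟩ := hP Empty (fun s => s.elim) ⊤ (fun s => (hS s).elim)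
      exact t.elim
    obtain ⟨a⟩ := hA
    exact ⟨fun p => p.2.elim, fun p => p.2.elim, fun T _ _ _ f => ⟨f a, fun p => p.2.elim⟩⟩
  · exact final_nonempty P hne hP φ hφ

end final


end DOAbProof

/-- The pseudovariety `DO ∩ Ab̄` is κ-reducible for pointlike sets. -/
theorem DOAb_kappa_reducible_for_pointlikes
    {S : Type} [Semigroup S] [Finite S]
    (P : Set S) (hP : IsDOAbPointlike P)
    (A : Type) [Finite A]
    (φ : FreeSemigroup A →ₙ* S) (hφ : Function.Surjective φ) :
    ∃ w : P → KTerm A,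
      (∀ p : P, KEval (fun a => φ (FreeSemigroup.of a)) (w p) (p : S)) ∧
      (∀ (T : Type) [Semigroup T] [Finite T], InDOAb T →
        ∀ f : A → T, ∃ t : T, ∀ p : P, KEval f (w p) t) := by
  exact DOAbProof.final_all P hP φ hφ
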